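/- arXiv:1708.00413 — 4 statements merged into one kernel-verified Lean document; each statement's English description precedes it below -/
import Mathlib

section
/- Let a, b, c be nonnegative integers such that a + b, b + c and a + c are all even and all positive, set d = a + b + c − 1, and let Δ ⊂ ℝ^d be a lattice simplex of dimension d such that, for some ordering of its vertices, Λ_Δ equals the subgroup Λ_2(a,b,c) of (ℝ/ℤ)^{a+b+c} generated by the two elements (1/2,…,1/2, 1/2,…,1/2, 0,…,0) and (0,…,0, 1/2,…,1/2, 1/2,…,1/2), where the three blocks have lengths a, b and c respectively. Then Vol(Δ) = 4 and δ(Δ,t) = 1 + t^{(b+c)/2} + t^{(a+c)/2} + t^{(a+b)/2}. -/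
open Pointwise Polynomial

noncomputable section

/-- The set of lattice points of `ℝ^d` (points with integer coordinates). -/
def latticePts (d : ℕ) : Set (Fin d → ℝ) := {x | ∀ i, ∃ z : ℤ, x i = (z : ℝ)}

/-- A lattice polytope: the convex hull of finitely many lattice points. -/
def IsLatticePolytope {d : ℕ} (P : Set (Fin d → ℝ)) : Prop :=
  ∃ V : Finset (Fin d → ℝ), (V : Set (Fin d → ℝ)) ⊆ latticePts d ∧
    P = convexHull ℝ (V : Set (Fin d → ℝ))

/-- `|nP ∩ ℤ^d|`. -/
def ehrhartCount {d : ℕ} (P : Set (Fin d → ℝ)) (n : ℕ) : ℕ :=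
  (latticePts d ∩ (n : ℝ) • P).ncard

/-- The Ehrhart series `1 + Σ_{n ≥ 1} |nP ∩ ℤ^d| tⁿ`. -/
def ehrhartSeries {d : ℕ} (P : Set (Fin d → ℝ)) : PowerSeries ℤ :=
  PowerSeries.mk fun n => if n = 0 then 1 else (ehrhartCount P n : ℤ)

/-- `p` is the δ-polynomial of the lattice polytope `P ⊆ ℝ^d` of dimension `d`,
i.e. `(1 - t)^(d+1) (1 + Σ_{n ≥ 1} |nP ∩ ℤ^d| tⁿ) = p`. -/
def HasDeltaPoly {d : ℕ} (P : Set (Fin d → ℝ)) (p : Polynomial ℤ) : Prop :=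
  (1 - PowerSeries.X) ^ (d + 1) * ehrhartSeries P = (p : PowerSeries ℤ)

/-- Unimodular equivalence: an affine map carrying `ℤ^d ∩ aff P` bijectively onto
`ℤ^e ∩ aff Q` and mapping `P` onto `Q`. -/
def UnimodEquiv {d e : ℕ} (P : Set (Fin d → ℝ)) (Q : Set (Fin e → ℝ)) : Prop :=
  ∃ f : (Fin d → ℝ) →ᵃ[ℝ] (Fin e → ℝ),
    Set.BijOn f (latticePts d ∩ (affineSpan ℝ P : Set (Fin d → ℝ)))
      (latticePts e ∩ (affineSpan ℝ Q : Set (Fin e → ℝ))) ∧ f '' P = Q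

/-- The lattice pyramid `Pyr(Q) = conv(Q × {0}, (0,…,0,1)) ⊆ ℝ^{e+1}`. -/
def pyramidOver {e : ℕ} (Q : Set (Fin e → ℝ)) : Set (Fin (e + 1) → ℝ) :=
  convexHull ℝ
    ((fun x : Fin e → ℝ => Fin.snoc x (0 : ℝ)) '' Q ∪ {Fin.snoc (0 : Fin e → ℝ) (1 : ℝ)})

/-- `P` is a lattice pyramid over some (full-dimensional) lattice polytope. -/
def IsLatticePyramid {d : ℕ} (P : Set (Fin d → ℝ)) : Prop :=
  ∃ (e : ℕ) (Q : Set (Fin e → ℝ)), IsLatticePolytope Q ∧ affineSpan ℝ Q = ⊤ ∧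
    UnimodEquiv P (pyramidOver Q)

/-- `P ⊆ ℝ^d` is a simplex (of some dimension). -/
def IsSimplex {d : ℕ} (P : Set (Fin d → ℝ)) : Prop :=
  ∃ (n : ℕ) (v : Fin (n + 1) → Fin d → ℝ), AffineIndependent ℝ v ∧
    P = convexHull ℝ (Set.range v)

/-- A full-dimensional lattice simplex of dimension `d` in `ℝ^d`. -/
def IsLatticeSimplexFD {d : ℕ} (Δ : Set (Fin d → ℝ)) : Prop :=
  ∃ v : Fin (d + 1) → Fin d → ℝ, AffineIndependent ℝ v ∧
    (∀ i, v i ∈ latticePts d) ∧ Δ = convexHull ℝ (Set.range v)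

/-- `ℤ((P,1) ∩ ℤ^{d+1}) = ℤ^{d+1}`: the lattice points of `P`, with last coordinate `1`
appended, generate all of `ℤ^{d+1}` as a group. -/
def SpansLattice {d : ℕ} (P : Set (Fin d → ℝ)) : Prop :=
  AddSubgroup.closure {y : Fin (d + 1) → ℤ |
    y (Fin.last d) = 1 ∧ (fun i : Fin d => (y i.castSucc : ℝ)) ∈ P} = ⊤

/-- The finite abelian group `Λ_Δ ⊆ (ℝ/ℤ)^{d+1}` attached to a lattice simplex with
ordered vertices `v 0, …, v d`, encoded by its canonical representatives in `[0,1)`. -/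
def simplexLambda {d : ℕ} (v : Fin (d + 1) → Fin d → ℝ) : Set (Fin (d + 1) → ℝ) :=
  {c | (∀ i, 0 ≤ c i ∧ c i < 1) ∧
    (∀ j : Fin d, ∃ z : ℤ, (∑ i, c i * v i j) = (z : ℝ)) ∧
    (∃ z : ℤ, (∑ i, c i) = (z : ℝ))}

/-- The standard basis vector `e_j` of `ℝ^d` (0-indexed). -/
def stdE (d : ℕ) (j : Fin d) : Fin d → ℝ := fun i => if i = j then 1 else 0

/-- The group `Λ₂(a,b,c) ⊆ (ℝ/ℤ)^{a+b+c}` generated by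
`(1/2,…,1/2, 1/2,…,1/2, 0,…,0)` and `(0,…,0, 1/2,…,1/2, 1/2,…,1/2)`
(blocks of lengths `a`, `b`, `c`), encoded by representatives in `[0,1)`. -/
def lambdaTwo (d a b : ℕ) : Set (Fin (d + 1) → ℝ) :=
  {x | ∃ j₁ j₂ : Fin 2, x = fun i : Fin (d + 1) =>
    Int.fract ((j₁.val : ℝ) * (if (i : ℕ) < a + b then (1 : ℝ) / 2 else 0) +
      (j₂.val : ℝ) * (if (i : ℕ) < a then (0 : ℝ) else 1 / 2))}

/-- The convex hull of a finite family dilated by `r ≥ 0` consists of the nonnegative combinations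
of total weight `r`. -/
theorem mem_smul_convexHull_range_iff {ι E : Type*} [Fintype ι] [Nonempty ι] [AddCommGroup E]
    [Module ℝ E] (v : ι → E) {r : ℝ} (hr : 0 ≤ r) (x : E) :
    x ∈ r • convexHull ℝ (Set.range v) ↔
      ∃ w : ι → ℝ, (∀ i, 0 ≤ w i) ∧ ∑ i, w i = r ∧ ∑ i, w i • v i = x := by
  classical
  have himage : convexHull ℝ (Set.range v) = Fintype.linearCombination ℝ v '' stdSimplex ℝ ι := by
    rw [← convexHull_rangle_single_eq_stdSimplex, LinearMap.image_convexHull, ← Set.range_comp]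
    congr 2
    ext i
    simp
  rw [himage]
  constructor
  · rintro ⟨_, ⟨w, ⟨hw, hw1⟩, rfl⟩, rfl⟩
    refine ⟨fun i => r * w i, fun i => mul_nonneg hr (hw i), ?_, ?_⟩
    · rw [← Finset.mul_sum, hw1, mul_one]
    · simp [Fintype.linearCombination_apply, Finset.smul_sum, mul_smul]
  · rintro ⟨w, hw, hwr, rfl⟩
    rcases hr.eq_or_lt with rfl | hr
    · have hw0 : ∀ i, w i = 0 := fun i =>
        (Finset.sum_eq_zero_iff_of_nonneg fun i _ => hw i).1 hwr i (Finset.mem_univ i)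
      obtain ⟨i⟩ := ‹Nonempty ι›
      exact ⟨_, ⟨Pi.single i 1, single_mem_stdSimplex ℝ i, rfl⟩, by simp [hw0]⟩
    · refine ⟨_, ⟨fun i => r⁻¹ * w i, ⟨fun i => mul_nonneg (inv_nonneg.2 hr.le) (hw i), ?_⟩, rfl⟩, ?_⟩
      · rw [← Finset.mul_sum, hwr, inv_mul_cancel₀ hr.ne']
      · simp [Fintype.linearCombination_apply, Finset.smul_sum, smul_smul, hr.ne']

theorem AffineIndependent.weights_eq {ι E : Type*} [Fintype ι] [AddCommGroup E] [Module ℝ E]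
    {v : ι → E} (hv : AffineIndependent ℝ v) {w w' : ι → ℝ} (hsum : ∑ i, w i = ∑ i, w' i)
    (hcomb : ∑ i, w i • v i = ∑ i, w' i • v i) : w = w' := by
  funext i
  have := affineIndependent_iff.1 hv Finset.univ (fun i => w i - w' i)
    (by rw [Finset.sum_sub_distrib, hsum, sub_self])
    (by simp only [sub_smul, Finset.sum_sub_distrib, hcomb, sub_self]) i (Finset.mem_univ i)
  exact sub_eq_zero.1 this

theorem exists_int_sum_natCast_mul {ι : Type*} [Fintype ι] (m : ι → ℕ) {u : ι → ℝ}
    (hu : ∀ i, ∃ z : ℤ, u i = z) : ∃ z : ℤ, ∑ i, (m i : ℝ) * u i = z := by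
  choose z hz using hu
  exact ⟨∑ i, (m i : ℤ) * z i, by simp [hz]⟩

/-- The lattice points of `nΔ` correspond to pairs of an element `λ` of `Λ_Δ` and a vector of
natural numbers with sum `n - ht(λ)`. -/
theorem ehrhartCount_convexHull_range {d : ℕ} {v : Fin (d + 1) → Fin d → ℝ}
    (hv : AffineIndependent ℝ v) (hvl : ∀ i, v i ∈ latticePts d)
    {κ : Type*} [Fintype κ] (l : κ → Fin (d + 1) → ℝ) (hl : Function.Injective l)
    (hrange : Set.range l = simplexLambda v) (h : κ → ℕ) (hh : ∀ k, ∑ i, l k i = h k) (n : ℕ) :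
    ehrhartCount (convexHull ℝ (Set.range v)) n =
      ∑ k, if h k ≤ n then
        (Finset.finsuppAntidiag (Finset.univ : Finset (Fin (d + 1))) (n - h k)).card else 0 := by
  classical
  have hmem : ∀ k, l k ∈ simplexLambda v := fun k => hrange ▸ Set.mem_range_self k
  let S : Finset (Σ _ : κ, Fin (d + 1) →₀ ℕ) := Finset.univ.sigma fun k =>
    if h k ≤ n then Finset.finsuppAntidiag (Finset.univ : Finset (Fin (d + 1))) (n - h k) else ∅
  have hS : ∀ p, p ∈ S ↔ h p.1 + ∑ i, p.2 i = n := by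
    intro p
    simp only [S, Finset.mem_sigma, Finset.mem_univ, true_and]
    split_ifs with hk
    · rw [Finset.mem_finsuppAntidiag, and_iff_left (Finset.subset_univ _)]
      change ∑ i, p.2 i = _ ↔ _
      omega
    · simp only [Finset.notMem_empty, false_iff]
      omega
  let F : (Σ _ : κ, Fin (d + 1) →₀ ℕ) → Fin d → ℝ := fun p =>
    ∑ i, (l p.1 i + p.2 i) • v i
  have hweight : ∀ p ∈ S, ∑ i, (l p.1 i + p.2 i) = n := by
    intro p hp
    rw [Finset.sum_add_distrib, hh]
    exact_mod_cast (hS p).1 hp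
  have hinj : Set.InjOn F S := by
    rintro ⟨k, m⟩ hp ⟨k', m'⟩ hq hF
    have hw := hv.weights_eq ((hweight _ hp).trans (hweight _ hq).symm) hF
    have hlk : l k = l k' := by
      funext i
      have := congrArg Int.fract (congrFun hw i)
      simpa [Int.fract_eq_self.2 ((hmem k).1 i), Int.fract_eq_self.2 ((hmem k').1 i)] using this
    obtain rfl := hl hlk
    have hm : m = m' := by
      ext i
      simpa using congrFun hw i
    rw [hm]
  have himage : latticePts d ∩ (n : ℝ) • convexHull ℝ (Set.range v) = F '' S := by
    ext x
    rw [Set.mem_inter_iff, mem_smul_convexHull_range_iff v n.cast_nonneg]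
    constructor
    · rintro ⟨hx, w, hw, hwn, rfl⟩
      have hdecomp : ∀ i, Int.fract (w i) + (⌊w i⌋₊ : ℝ) = w i := fun i => by
        rw [natCast_floor_eq_intCast_floor (hw i), Int.fract_add_floor]
      have hfract : (fun i => Int.fract (w i)) ∈ simplexLambda v := by
        refine ⟨fun i => ⟨Int.fract_nonneg _, Int.fract_lt_one _⟩, fun j => ?_, ?_⟩
        · obtain ⟨z, hz⟩ := hx j
          obtain ⟨y, hy⟩ := exists_int_sum_natCast_mul (fun i => ⌊w i⌋₊) fun i => hvl i j
          refine ⟨z - y, ?_⟩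
          push_cast
          rw [← hz, ← hy, Finset.sum_apply, ← Finset.sum_sub_distrib]
          refine Finset.sum_congr rfl fun i _ => ?_
          rw [Pi.smul_apply, smul_eq_mul, ← sub_mul, eq_sub_of_add_eq (hdecomp i)]
        · refine ⟨n - ∑ i, (⌊w i⌋₊ : ℤ), ?_⟩
          push_cast
          rw [← hwn, ← Finset.sum_sub_distrib]
          exact Finset.sum_congr rfl fun i _ => eq_sub_of_add_eq (hdecomp i)
      rw [← hrange] at hfract
      obtain ⟨k, hk⟩ := hfract
      refine ⟨⟨k, Finsupp.equivFunOnFinite.symm fun i => ⌊w i⌋₊⟩, ?_, ?_⟩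
      · rw [Finset.mem_coe, hS]
        have : (h k : ℝ) + ∑ i, (⌊w i⌋₊ : ℝ) = n := by
          rw [← hh, ← Finset.sum_add_distrib, ← hwn]
          exact Finset.sum_congr rfl fun i _ => by rw [hk, hdecomp]
        simpa using (by exact_mod_cast this : h k + ∑ i, ⌊w i⌋₊ = n)
      · refine Finset.sum_congr rfl fun i _ => ?_
        simp [hk, hdecomp]
    · rintro ⟨p, hp, rfl⟩
      refine ⟨fun j => ?_, fun i => l p.1 i + p.2 i,
        fun i => add_nonneg ((hmem p.1).1 i).1 (Nat.cast_nonneg _), hweight p hp, rfl⟩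
      obtain ⟨z, hz⟩ := (hmem p.1).2.1 j
      obtain ⟨y, hy⟩ := exists_int_sum_natCast_mul p.2 fun i => hvl i j
      refine ⟨z + y, ?_⟩
      push_cast
      rw [← hz, ← hy, ← Finset.sum_add_distrib]
      simp [F, add_mul]
  rw [ehrhartCount, himage, hinj.ncard_image, Set.ncard_coe_finset,
    Finset.card_sigma]
  refine Finset.sum_congr rfl fun k _ => ?_
  split_ifs <;> simp

/-- The δ-polynomial of a lattice simplex is the generating function of the heights on `Λ_Δ`. -/
theorem hasDeltaPoly_convexHull_range {d : ℕ} {v : Fin (d + 1) → Fin d → ℝ}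
    (hv : AffineIndependent ℝ v) (hvl : ∀ i, v i ∈ latticePts d)
    {κ : Type*} [Fintype κ] (l : κ → Fin (d + 1) → ℝ) (hl : Function.Injective l)
    (hrange : Set.range l = simplexLambda v) (h : κ → ℕ) (hh : ∀ k, ∑ i, l k i = h k) :
    HasDeltaPoly (convexHull ℝ (Set.range v)) (∑ k, X ^ h k) := by
  have hzero : ehrhartCount (convexHull ℝ (Set.range v)) 0 = 1 := by
    have : latticePts d ∩ ((0 : ℕ) : ℝ) • convexHull ℝ (Set.range v) = {0} := by
      rw [Nat.cast_zero, Set.zero_smul_set (Set.range_nonempty v).convexHull, ← Set.singleton_zero, Set.inter_eq_right]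
      rintro _ rfl j
      exact ⟨0, by simp⟩
    rw [ehrhartCount, this, Set.ncard_singleton]
  have hseries : ehrhartSeries (convexHull ℝ (Set.range v)) =
      (∑ k, PowerSeries.X ^ h k) * PowerSeries.mk (1 : ℕ → ℤ) ^ (d + 1) := by
    ext n
    have hcoeff : PowerSeries.coeff n (ehrhartSeries (convexHull ℝ (Set.range v))) =
        (ehrhartCount (convexHull ℝ (Set.range v)) n : ℤ) := by
      rw [ehrhartSeries, PowerSeries.coeff_mk]
      split_ifs with hn
      · simp [hn, hzero]
      · rfl
    rw [hcoeff, ehrhartCount_convexHull_range hv hvl l hl hrange h hh, Finset.sum_mul, map_sum,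
      Nat.cast_sum]
    refine Finset.sum_congr rfl fun k _ => ?_
    rw [PowerSeries.coeff_X_pow_mul']
    split_ifs
    · have hprod : PowerSeries.mk (1 : ℕ → ℤ) ^ (d + 1) =
          ∏ _i : Fin (d + 1), PowerSeries.mk (1 : ℕ → ℤ) := by simp
      rw [hprod, PowerSeries.coeff_prod]
      simp
    · rfl
  rw [HasDeltaPoly, hseries, mul_left_comm, ← mul_pow, mul_comm (1 - PowerSeries.X),
    PowerSeries.mk_one_mul_one_sub_eq_one, one_pow, mul_one]
  rw [← Polynomial.coeToPowerSeries.ringHom_apply, map_sum]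
  simp

theorem sum_fin_ite_lt {n k : ℕ} (hk : k ≤ n) :
    ∑ i : Fin n, (if (i : ℕ) < k then (1 : ℝ) else 0) = k := by
  rw [Fin.sum_univ_eq_sum_range (fun i => if i < k then (1 : ℝ) else 0) n, Finset.sum_ite]
  have : Finset.filter (· < k) (Finset.range n) = Finset.range k := by
    ext i
    simp only [Finset.mem_filter, Finset.mem_range]
    omega
  simp [this]

/-- The representatives in `[0,1)` of the elements of `Λ₂(a,b,c)`. -/
def lambdaTwoElem (d a b : ℕ) : Option (Fin 3) → Fin (d + 1) → ℝ
  | none, _ => 0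
  | some 0, i => if (i : ℕ) < a then 0 else 1 / 2
  | some 1, i => if (i : ℕ) < a then 1 / 2 else if (i : ℕ) < a + b then 0 else 1 / 2
  | some 2, i => if (i : ℕ) < a + b then 1 / 2 else 0

theorem range_lambdaTwoElem (d a b : ℕ) : Set.range (lambdaTwoElem d a b) = lambdaTwo d a b := by
  have hhalf : Int.fract (2⁻¹ : ℝ) = 2⁻¹ := Int.fract_eq_self.2 (by norm_num)
  have hone : Int.fract ((2⁻¹ : ℝ) + 2⁻¹) = 0 := by norm_num
  have h00 : lambdaTwoElem d a b none = fun i : Fin (d + 1) =>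
      Int.fract ((((0 : Fin 2).val : ℕ) : ℝ) * (if (i : ℕ) < a + b then (1 : ℝ) / 2 else 0) +
        (((0 : Fin 2).val : ℕ) : ℝ) * (if (i : ℕ) < a then (0 : ℝ) else 1 / 2)) := by
    funext i
    simp [lambdaTwoElem]
  have h01 : lambdaTwoElem d a b (some 0) = fun i : Fin (d + 1) =>
      Int.fract ((((0 : Fin 2).val : ℕ) : ℝ) * (if (i : ℕ) < a + b then (1 : ℝ) / 2 else 0) +
        (((1 : Fin 2).val : ℕ) : ℝ) * (if (i : ℕ) < a then (0 : ℝ) else 1 / 2)) := by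
    funext i
    simp only [lambdaTwoElem]
    split_ifs <;> simp [hhalf]
  have h10 : lambdaTwoElem d a b (some 2) = fun i : Fin (d + 1) =>
      Int.fract ((((1 : Fin 2).val : ℕ) : ℝ) * (if (i : ℕ) < a + b then (1 : ℝ) / 2 else 0) +
        (((0 : Fin 2).val : ℕ) : ℝ) * (if (i : ℕ) < a then (0 : ℝ) else 1 / 2)) := by
    funext i
    simp only [lambdaTwoElem]
    split_ifs <;> simp [hhalf]
  have h11 : lambdaTwoElem d a b (some 1) = fun i : Fin (d + 1) =>
      Int.fract ((((1 : Fin 2).val : ℕ) : ℝ) * (if (i : ℕ) < a + b then (1 : ℝ) / 2 else 0) +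
        (((1 : Fin 2).val : ℕ) : ℝ) * (if (i : ℕ) < a then (0 : ℝ) else 1 / 2)) := by
    funext i
    simp only [lambdaTwoElem]
    split_ifs <;> first | omega | simp [hhalf, hone]
  ext x
  constructor
  · rintro ⟨k, rfl⟩
    match k with
    | none => exact ⟨0, 0, h00⟩
    | some 0 => exact ⟨0, 1, h01⟩
    | some 1 => exact ⟨1, 1, h11⟩
    | some 2 => exact ⟨1, 0, h10⟩
  · rintro ⟨j₁, j₂, rfl⟩
    match j₁, j₂ with
    | 0, 0 => exact ⟨_, h00⟩
    | 0, 1 => exact ⟨_, h01⟩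
    | 1, 1 => exact ⟨_, h11⟩
    | 1, 0 => exact ⟨_, h10⟩

theorem lambdaTwoElem_injective {a b c d : ℕ} (hd : d + 1 = a + b + c) (hab : 0 < a + b)
    (hbc : 0 < b + c) (hca : 0 < a + c) : Function.Injective (lambdaTwoElem d a b) := by
  intro k k' hk
  have hfirst := congrFun hk 0
  have hlast := congrFun hk (Fin.last d)
  have hla : ¬ d < a := by omega
  have hlb : d < a + b ↔ c = 0 := by omega
  rcases Nat.eq_zero_or_pos a with ha | ha <;> rcases Nat.eq_zero_or_pos c with hc | hc
  · omega
  · have hb : 0 < b := by omega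
    have hdb : ¬ d < b := by omega
    fin_cases k <;> fin_cases k' <;>
      first
        | rfl
        | simp [lambdaTwoElem, ha, hb, hdb] at hfirst hlast
  all_goals
    fin_cases k <;> fin_cases k' <;>
      first
        | rfl
        | simp [lambdaTwoElem, hla, hlb, ha, hc.ne'] at hfirst hlast
        | simp [lambdaTwoElem, hla, hlb, ha, hc] at hfirst hlast

/-- The heights of the elements of `Λ₂(a,b,c)`. -/
def lambdaTwoHeight (a b c : ℕ) : Option (Fin 3) → ℕ
  | none => 0
  | some 0 => (b + c) / 2
  | some 1 => (a + c) / 2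
  | some 2 => (a + b) / 2

theorem sum_lambdaTwoElem {a b c d : ℕ} (hd : d + 1 = a + b + c) (hab : Even (a + b))
    (hbc : Even (b + c)) (hca : Even (a + c)) (k : Option (Fin 3)) :
    ∑ i, lambdaTwoElem d a b k i = lambdaTwoHeight a b c k := by
  have hA := sum_fin_ite_lt (show a ≤ d + 1 by omega)
  have hB := sum_fin_ite_lt (show a + b ≤ d + 1 by omega)
  have hC : ∑ _i : Fin (d + 1), (1 : ℝ) = a + b + c := by
    rw [Finset.sum_const, Finset.card_univ, Fintype.card_fin, hd]
    simp
  match k with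
  | none => simp [lambdaTwoElem, lambdaTwoHeight]
  | some 0 =>
    rw [lambdaTwoHeight, Nat.cast_div hbc.two_dvd two_ne_zero]
    trans (∑ _i : Fin (d + 1), (1 : ℝ) -
      ∑ i : Fin (d + 1), (if (i : ℕ) < a then (1 : ℝ) else 0)) / 2
    · rw [← Finset.sum_sub_distrib, Finset.sum_div]
      refine Finset.sum_congr rfl fun i _ => ?_
      simp only [lambdaTwoElem]
      split_ifs <;> norm_num
    · rw [hA, hC]
      push_cast
      ring
  | some 1 =>
    rw [lambdaTwoHeight, Nat.cast_div hca.two_dvd two_ne_zero]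
    trans (∑ _i : Fin (d + 1), (1 : ℝ) -
      ∑ i : Fin (d + 1), (if (i : ℕ) < a + b then (1 : ℝ) else 0) +
      ∑ i : Fin (d + 1), (if (i : ℕ) < a then (1 : ℝ) else 0)) / 2
    · rw [← Finset.sum_sub_distrib, ← Finset.sum_add_distrib, Finset.sum_div]
      refine Finset.sum_congr rfl fun i _ => ?_
      simp only [lambdaTwoElem]
      split_ifs <;> first | omega | norm_num
    · rw [hA, hB, hC]
      push_cast
      ring
  | some 2 =>
    rw [lambdaTwoHeight, Nat.cast_div hab.two_dvd two_ne_zero]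
    trans (∑ i : Fin (d + 1), (if (i : ℕ) < a + b then (1 : ℝ) else 0)) / 2
    · rw [Finset.sum_div]
      refine Finset.sum_congr rfl fun i _ => ?_
      simp only [lambdaTwoElem]
      split_ifs <;> norm_num
    · rw [hB]
      push_cast
      ring

/-- a lattice simplex whose group is `Λ₂(a,b,c)` has normalized volume 4 and
δ-polynomial `1 + t^{(b+c)/2} + t^{(a+c)/2} + t^{(a+b)/2}`. -/
theorem delta_of_lambdaTwo_simplex (a b c : ℕ)
    (hab : Even (a + b)) (hbc : Even (b + c)) (hca : Even (a + c))
    (hab' : 0 < a + b) (hbc' : 0 < b + c) (hca' : 0 < a + c)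
    (d : ℕ) (hd : d + 1 = a + b + c) (Δ : Set (Fin d → ℝ))
    (v : Fin (d + 1) → Fin d → ℝ) (hv : AffineIndependent ℝ v)
    (hvl : ∀ i, v i ∈ latticePts d) (hΔ : Δ = convexHull ℝ (Set.range v))
    (hΛ : simplexLambda v = lambdaTwo d a b) :
    HasDeltaPoly Δ
      (1 + X ^ ((b + c) / 2) + X ^ ((a + c) / 2) + X ^ ((a + b) / 2)) ∧
    ((1 + X ^ ((b + c) / 2) + X ^ ((a + c) / 2) + X ^ ((a + b) / 2) :
        Polynomial ℤ).eval 1 = 4) := by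
  subst hΔ
  refine ⟨?_, by norm_num⟩
  have := hasDeltaPoly_convexHull_range hv hvl (lambdaTwoElem d a b)
    (lambdaTwoElem_injective hd hab' hbc' hca') ((range_lambdaTwoElem d a b).trans hΛ.symm)
    (lambdaTwoHeight a b c) (sum_lambdaTwoElem hd hab hbc hca)
  simpa [Fintype.sum_option, Fin.sum_univ_three, lambdaTwoHeight, add_assoc] using this
end
end

section
/- Let k ≥ 2 and d = 2k, and let A^(4)_1 = conv{0, e_1, …, e_{d−1}, Σ_{j=1}^{d−2} e_j + 2e_d, e_1 − e_{d−1}} ⊂ ℝ^d. Then A^(4)_1 is a lattice polytope of dimension d with exactly d + 2 vertices which is not a simplex and not a lattice pyramid, its δ-polynomial equals 1 + t + t^k + t^{k+1} (so Vol(A^(4)_1) = 4), and ℤ((A^(4)_1, 1) ∩ ℤ^{d+1}) ≠ ℤ^{d+1}. -/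
open Pointwise Polynomial

noncomputable section

/-- `A⁽⁴⁾₁ = conv{0, e₁, …, e_{d−1}, Σ_{j=1}^{d−2} e_j + 2e_d, e₁ − e_{d−1}} ⊆ ℝ^d`. -/
def polyA41 (d : ℕ) : Set (Fin d → ℝ) :=
  convexHull ℝ
    ({0,
      fun j : Fin d => if (j : ℕ) = d - 1 then (2 : ℝ) else if (j : ℕ) + 2 < d then 1 else 0,
      fun j : Fin d => if (j : ℕ) = 0 then (1 : ℝ) else if (j : ℕ) = d - 2 then -1 else 0} ∪
      {x | ∃ j : Fin d, (j : ℕ) < d - 1 ∧ x = stdE d j})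

/-- `A⁽⁴⁾₂ = conv{0, e₁, …, e_{d−1}, Σ_{j=1}^{d−3} e_j + 2e_d, e_{d−2} + e_{d−1}} ⊆ ℝ^d`. -/
def polyA42 (d : ℕ) : Set (Fin d → ℝ) :=
  convexHull ℝ
    ({0,
      fun j : Fin d => if (j : ℕ) = d - 1 then (2 : ℝ) else if (j : ℕ) + 3 < d then 1 else 0,
      fun j : Fin d => if (j : ℕ) = d - 3 ∨ (j : ℕ) = d - 2 then (1 : ℝ) else 0} ∪
      {x | ∃ j : Fin d, (j : ℕ) < d - 1 ∧ x = stdE d j})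

/-- `A⁽⁴⁾₃ = conv{0, e₁, …, e_{d−1}, Σ_{j=1}^{d−4} e_j + 2e_d, −e_{d−3} + e_{d−2} + e_{d−1}} ⊆ ℝ^d`. -/
def polyA43 (d : ℕ) : Set (Fin d → ℝ) :=
  convexHull ℝ
    ({0,
      fun j : Fin d => if (j : ℕ) = d - 1 then (2 : ℝ) else if (j : ℕ) + 4 < d then 1 else 0,
      fun j : Fin d =>
        if (j : ℕ) = d - 4 then (-1 : ℝ)
        else if (j : ℕ) = d - 3 ∨ (j : ℕ) = d - 2 then 1 else 0} ∪
      {x | ∃ j : Fin d, (j : ℕ) < d - 1 ∧ x = stdE d j})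

/-- `B⁽⁴⁾ = conv{0, e₁, …, e_{d−1}, Σ_{j=1}^{d−2} e_j + 2e_d, −e₁ + e_{d−1}} ⊆ ℝ^d`. -/
def polyB4 (d : ℕ) : Set (Fin d → ℝ) :=
  convexHull ℝ
    ({0,
      fun j : Fin d => if (j : ℕ) = d - 1 then (2 : ℝ) else if (j : ℕ) + 2 < d then 1 else 0,
      fun j : Fin d => if (j : ℕ) = 0 then (-1 : ℝ) else if (j : ℕ) = d - 2 then 1 else 0} ∪
      {x | ∃ j : Fin d, (j : ℕ) < d - 1 ∧ x = stdE d j})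

/-- The inequalities describing the `n`-th dilate of the polytope with vertices `0`,
`e_j` (`j ≠ il`), `e_{i0} - e_{iq}` and `Σ_j e_j - e_{iq} + e_{il}`. -/
def DilateIneq {R : Type*} [CommRing R] [LinearOrder R] {d : ℕ} (i0 iq il : Fin d) (n : R)
    (x : Fin d → R) : Prop :=
  0 ≤ x il ∧ (∀ j, j ≠ iq → j ≠ il → x il ≤ 2 * x j) ∧ x il ≤ 2 * x i0 + 2 * x iq ∧
    2 * ∑ j, x j - (d - 1) * x il ≤ 2 * n ∧
    2 * ∑ j, x j - (d - 1) * x il - 2 * x iq ≤ 2 * n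

/-- A parametrization of the integer solutions of `DilateIneq` by natural vectors `z` and
two bits `ε`, `σ`: the parity of the last coordinate and the sign of coordinate `iq`. -/
def dilateParam {d : ℕ} (i0 iq il : Fin d) (ε σ : ℕ) (z : Fin d → ℕ) : Fin d → ℤ :=
  fun j => z j + (z il + ε) + (if j = iq then -(σ * (2 * z iq + 1) : ℤ) - (z il + ε) else 0) +
    (if j = i0 then (σ * (z iq + 1) : ℤ) else 0)

lemma sum_dilateParam {d : ℕ} (i0 iq il : Fin d) (ε σ : ℕ) (z : Fin d → ℕ) :
    ∑ j, dilateParam i0 iq il ε σ z j =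
      ∑ j, (z j : ℤ) + (d - 1) * (z il + ε) - σ * z iq := by
  simp only [dilateParam, Finset.sum_add_distrib, Finset.sum_ite_eq', Finset.mem_univ, if_true,
    Finset.sum_const, Finset.card_univ, Fintype.card_fin, nsmul_eq_mul]
  ring

lemma dilateParam_mem {d k : ℕ} (hd : d = 2 * k) {i0 iq il : Fin d} (h0q : i0 ≠ iq)
    (h0l : i0 ≠ il) (hql : iq ≠ il) {ε σ n : ℕ} (hε : ε ≤ 1) (hσ : σ ≤ 1) {z : Fin d → ℕ}
    (hz : ∑ j, z j + (k * ε + σ) ≤ n) :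
    DilateIneq i0 iq il (n : ℤ) (dilateParam i0 iq il ε σ z) := by
  have hz' : ∑ j, (z j : ℤ) + (k * ε + σ) ≤ n := by exact_mod_cast hz
  have hd' : (d : ℤ) = 2 * k := by exact_mod_cast hd
  have hl : dilateParam i0 iq il ε σ z il = 2 * z il + ε := by
    simp [dilateParam, h0l.symm, hql.symm]; ring
  have hq : dilateParam i0 iq il ε σ z iq = z iq - σ * (2 * z iq + 1) := by
    simp [dilateParam, h0q.symm]; ring
  refine ⟨by rw [hl]; positivity, fun j hjq hjl => ?_, ?_, ?_, ?_⟩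
  · rw [hl]
    by_cases hj : j = i0
    · subst hj
      have : dilateParam j iq il ε σ z j = z j + (z il + ε) + σ * (z iq + 1) := by
        simp [dilateParam, hjq]
      rw [this]
      have : (0 : ℤ) ≤ σ * (z iq + 1) := by positivity
      omega
    · have : dilateParam i0 iq il ε σ z j = z j + (z il + ε) := by
        simp [dilateParam, hjq, hj]
      omega
  · have : dilateParam i0 iq il ε σ z i0 = z i0 + (z il + ε) + σ * (z iq + 1) := by
      simp [dilateParam, h0q]
    rw [hl, hq, this]
    interval_cases σ <;> push_cast <;> linarith
  · rw [sum_dilateParam, hl]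
    have : (0 : ℤ) ≤ σ * z iq := by positivity
    have hε' : (ε : ℤ) ≤ 1 := by exact_mod_cast hε
    rw [hd']
    interval_cases ε <;> push_cast at * <;> linarith
  · rw [sum_dilateParam, hl, hq, hd']
    interval_cases ε <;> interval_cases σ <;> push_cast at * <;> linarith

lemma exists_dilateParam {d k : ℕ} (hd : d = 2 * k) {i0 iq il : Fin d} (h0q : i0 ≠ iq)
    (h0l : i0 ≠ il) (hql : iq ≠ il) {n : ℕ} {x : Fin d → ℤ}
    (hx : DilateIneq i0 iq il (n : ℤ) x) :
    ∃ ε ≤ 1, ∃ σ ≤ 1, ∃ z : Fin d → ℕ,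
      ∑ j, z j + (k * ε + σ) ≤ n ∧ dilateParam i0 iq il ε σ z = x := by
  obtain ⟨hl, hj, h0, hA, hB⟩ := hx
  have hd' : (d : ℤ) = 2 * k := by exact_mod_cast hd
  obtain ⟨ε, hε⟩ : ∃ ε : ℕ, (ε : ℤ) = x il % 2 := ⟨(x il % 2).toNat, by omega⟩
  obtain ⟨c, hc⟩ : ∃ c : ℕ, (c : ℤ) = x il / 2 := ⟨(x il / 2).toNat, by omega⟩
  obtain ⟨σ, q, hσ, hq⟩ : ∃ σ q : ℕ, σ ≤ 1 ∧ x iq = q - σ * (2 * q + 1) := by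
    rcases lt_or_ge (x iq) 0 with h | h
    · exact ⟨1, (-x iq - 1).toNat, le_rfl, by push_cast; omega⟩
    · exact ⟨0, (x iq).toNat, zero_le_one, by push_cast; omega⟩
  have hε1 : ε ≤ 1 := by omega
  have hj0 := hj i0 h0q h0l
  have hnn : ∀ j, 0 ≤ x j - (c + ε) -
      (if j = iq then -(σ * (2 * q + 1) : ℤ) - (c + ε) else 0) -
      (if j = i0 then (σ * (q + 1) : ℤ) else 0) := by
    intro j
    by_cases h1 : j = iq
    · subst h1
      simp only [if_true, if_neg h0q.symm, hq]
      linarith [Int.natCast_nonneg q]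
    · by_cases h2 : j = i0
      · subst h2
        simp only [if_true, if_neg h1]
        interval_cases σ <;> push_cast at * <;> omega
      · simp only [if_neg h1, if_neg h2]
        by_cases h3 : j = il
        · subst h3; omega
        · have := hj j h1 h3
          omega
  choose z hz using fun j => Int.eq_ofNat_of_zero_le (hnn j)
  have hzl : z il = c := by
    have := hz il
    simp only [if_neg hql.symm, if_neg h0l.symm] at this
    omega
  have hzq : z iq = q := by
    have := hz iq
    simp only [if_true, if_neg h0q.symm, hq] at this
    have h2 : (z iq : ℤ) = q := by linarith
    exact_mod_cast h2
  have hparam : dilateParam i0 iq il ε σ z = x := by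
    funext j
    simp only [dilateParam, hzl, hzq, ← hz j]
    ring
  refine ⟨ε, hε1, σ, hσ, z, ?_, hparam⟩
  have hsum := sum_dilateParam i0 iq il ε σ z
  rw [hparam, hzl, hzq] at hsum
  rw [hsum, hd'] at hA hB
  rw [hq] at hB
  have hxl : x il = 2 * c + ε := by omega
  rw [hxl] at hA hB
  suffices h : ∑ j, (z j : ℤ) + (k * ε + σ) ≤ n by exact_mod_cast h
  interval_cases ε <;> interval_cases σ <;> push_cast at * <;> ring_nf at hA hB ⊢ <;> omega

lemma dilateParam_injective {d : ℕ} {i0 iq il : Fin d} (h0q : i0 ≠ iq)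
    (h0l : i0 ≠ il) (hql : iq ≠ il) {ε σ ε' σ' : ℕ} (hε : ε ≤ 1) (hσ : σ ≤ 1) (hε' : ε' ≤ 1)
    (hσ' : σ' ≤ 1) {z z' : Fin d → ℕ}
    (h : dilateParam i0 iq il ε σ z = dilateParam i0 iq il ε' σ' z') :
    ε = ε' ∧ σ = σ' ∧ z = z' := by
  have hl := congrFun h il
  have hq := congrFun h iq
  simp only [dilateParam, if_neg hql.symm, if_neg h0l.symm] at hl
  simp only [dilateParam, if_neg h0q.symm, if_true] at hq
  have hεε : ε = ε' := by omega
  have hll : z il = z' il := by omega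
  have hqq : σ = σ' ∧ z iq = z' iq := by
    interval_cases σ <;> interval_cases σ' <;> push_cast at hq <;> omega
  obtain ⟨rfl, hqq⟩ := hqq
  refine ⟨hεε, rfl, funext fun j => ?_⟩
  have hj := congrFun h j
  simp only [dilateParam, hll, hqq, hεε] at hj
  omega

lemma finite_sum_add_le (d m n : ℕ) : {z : Fin d → ℕ | ∑ j, z j + m ≤ n}.Finite := by
  refine (Set.finite_Iic (fun _ : Fin d => n)).subset fun z hz j => ?_
  have := Finset.single_le_sum (f := z) (fun _ _ => Nat.zero_le _) (Finset.mem_univ j)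
  simp only [Set.mem_ofPred_eq] at hz
  change z j ≤ n
  omega

lemma ncard_sum_add_le (d m n : ℕ) :
    {z : Fin d → ℕ | ∑ j, z j + m ≤ n}.ncard =
      if m ≤ n then (d + (n - m)).choose d else 0 := by
  split_ifs with hmn
  · have hcard := Finset.card_finsuppAntidiag_nat_eq_choose
      (s := (Finset.univ : Finset (Fin (d + 1)))) (n - m)
    rw [Finset.card_univ, Fintype.card_fin, Nat.add_right_comm, Nat.add_sub_cancel,
      Nat.choose_symm_add.symm] at hcard
    rw [← hcard, ← Set.ncard_coe_finset]
    refine Set.ncard_congr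
      (fun z _ => Finsupp.equivFunOnFinite.symm (Fin.cons (n - m - ∑ j, z j) z)) ?_ ?_ ?_
    · intro z hz
      simp only [Set.mem_ofPred_eq] at hz
      simp [Fin.sum_univ_succ]
      omega
    · intro a b _ _ hab
      exact (Fin.cons_injective2 (Finsupp.equivFunOnFinite.symm.injective hab)).2
    · intro f hf
      simp [Fin.sum_univ_succ] at hf
      refine ⟨fun j => f j.succ, by simp only [Set.mem_ofPred_eq]; omega, ?_⟩
      ext j
      refine Fin.cases ?_ (fun j => ?_) j
      · simp; omega
      · simp
  · rw [Set.ncard_eq_zero (finite_sum_add_le d m n), Set.eq_empty_iff_forall_notMem]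
    intro z hz
    simp only [Set.mem_ofPred_eq] at hz
    omega

lemma ncard_dilateIneq {d k : ℕ} (hd : d = 2 * k) {i0 iq il : Fin d} (h0q : i0 ≠ iq)
    (h0l : i0 ≠ il) (hql : iq ≠ il) (n : ℕ) :
    {x : Fin d → ℤ | DilateIneq i0 iq il (n : ℤ) x}.ncard =
      ∑ m ∈ {0, 1}, ∑ s ∈ {0, 1},
        if k * m + s ≤ n then (d + (n - (k * m + s))).choose d else 0 := by
  let S (ε σ : ℕ) : Set (Fin d → ℤ) :=
    dilateParam i0 iq il ε σ '' {z : Fin d → ℕ | ∑ j, z j + (k * ε + σ) ≤ n}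
  have hfin (ε σ : ℕ) : (S ε σ).Finite := (finite_sum_add_le _ _ _).image _
  have hcard {ε σ : ℕ} (hε : ε ≤ 1) (hσ : σ ≤ 1) : (S ε σ).ncard =
      if k * ε + σ ≤ n then (d + (n - (k * ε + σ))).choose d else 0 := by
    rw [← ncard_sum_add_le]
    exact Set.ncard_image_of_injective _ fun a b hab =>
      (dilateParam_injective h0q h0l hql hε hσ hε hσ hab).2.2
  have hdisj {ε σ ε' σ' : ℕ} (hε : ε ≤ 1) (hσ : σ ≤ 1) (hε' : ε' ≤ 1) (hσ' : σ' ≤ 1)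
      (hne : ¬ (ε = ε' ∧ σ = σ')) : Disjoint (S ε σ) (S ε' σ') := by
    rw [Set.disjoint_left]
    rintro _ ⟨a, -, rfl⟩ ⟨b, -, hab⟩
    obtain ⟨h1, h2, -⟩ := dilateParam_injective h0q h0l hql hε' hσ' hε hσ hab
    exact hne ⟨h1.symm, h2.symm⟩
  have hunion : {x : Fin d → ℤ | DilateIneq i0 iq il (n : ℤ) x} =
      (S 0 0 ∪ S 0 1) ∪ (S 1 0 ∪ S 1 1) := by
    ext x
    constructor
    · intro hx
      obtain ⟨ε, hε, σ, hσ, z, hz, rfl⟩ := exists_dilateParam hd h0q h0l hql hx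
      have : dilateParam i0 iq il ε σ z ∈ S ε σ := ⟨z, hz, rfl⟩
      interval_cases ε <;> interval_cases σ <;> simp only [Set.mem_union] <;> tauto
    · rintro ((⟨z, hz, rfl⟩ | ⟨z, hz, rfl⟩) | (⟨z, hz, rfl⟩ | ⟨z, hz, rfl⟩)) <;>
        exact dilateParam_mem hd h0q h0l hql (by simp) (by simp) hz
  rw [hunion, Set.ncard_union_eq _ ((hfin _ _).union (hfin _ _)) ((hfin _ _).union (hfin _ _)),
    Set.ncard_union_eq (hdisj (by simp) (by simp) (by simp) (by simp) (by simp)) (hfin _ _)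
      (hfin _ _),
    Set.ncard_union_eq (hdisj (by simp) (by simp) (by simp) (by simp) (by simp)) (hfin _ _)
      (hfin _ _)]
  · rw [Finset.sum_pair (by simp), Finset.sum_pair (by simp), Finset.sum_pair (by simp)]
    simp only [hcard, le_refl, zero_le_one]
  · simp only [Set.disjoint_union_left, Set.disjoint_union_right]
    exact ⟨⟨hdisj (by simp) (by simp) (by simp) (by simp) (by simp),
      hdisj (by simp) (by simp) (by simp) (by simp) (by simp)⟩,
      hdisj (by simp) (by simp) (by simp) (by simp) (by simp),
      hdisj (by simp) (by simp) (by simp) (by simp) (by simp)⟩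

lemma one_sub_X_pow_mul_mk_choose (d : ℕ) :
    (1 - PowerSeries.X : PowerSeries ℤ) ^ (d + 1) *
      PowerSeries.mk (fun n => ((d + n).choose d : ℤ)) = 1 := by
  rw [← PowerSeries.mk_one_pow_eq_mk_choose_add, ← mul_pow, mul_comm,
    PowerSeries.mk_one_mul_one_sub_eq_one, one_pow]

lemma hasDeltaPoly_of_count {d k : ℕ} (hk : 1 ≤ k) {P : Set (Fin d → ℝ)}
    (h : ∀ n, 0 < n → ehrhartCount P n = ∑ m ∈ {0, 1}, ∑ s ∈ {0, 1},
        if k * m + s ≤ n then (d + (n - (k * m + s))).choose d else 0) :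
    HasDeltaPoly P (1 + X + X ^ k + X ^ (k + 1)) := by
  have key : ehrhartSeries P = PowerSeries.mk (fun n => ((d + n).choose d : ℤ)) *
      (1 + PowerSeries.X ^ 1 + PowerSeries.X ^ k + PowerSeries.X ^ (k + 1)) := by
    ext n
    simp only [mul_add, mul_one, map_add, PowerSeries.coeff_mul_X_pow', PowerSeries.coeff_mk,
      ehrhartSeries]
    split_ifs with hn
    any_goals omega
    · simp [hn]
    all_goals
      rw [h n (Nat.pos_of_ne_zero hn), Finset.sum_pair (by simp), Finset.sum_pair (by simp),
        Finset.sum_pair (by simp)]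
      simp [*]
      try ring
  rw [HasDeltaPoly, key, ← mul_assoc, one_sub_X_pow_mul_mk_choose, one_mul]
  simp

section Polytope

variable {d : ℕ}

/-- The vector `Σ_j e_j - e_{iq} + e_{il}`. -/
def topVertex (iq il : Fin d) : Fin d → ℝ :=
  fun j => 1 - (if j = iq then 1 else 0) + (if j = il then 1 else 0)

/-- The vector `e_{i0} - e_{iq}`. -/
def sideVertex (i0 iq : Fin d) : Fin d → ℝ :=
  fun j => (if j = i0 then 1 else 0) - (if j = iq then 1 else 0)

/-- The vertices of `polyA41`, in terms of the first and the last two indices. -/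
def vertexSet (i0 iq il : Fin d) : Set (Fin d → ℝ) :=
  {0, topVertex iq il, sideVertex i0 iq} ∪ stdE d '' {j | j ≠ il}

lemma polyA41_eq_convexHull {i0 iq il : Fin d} (h0 : (i0 : ℕ) = 0) (hq : (iq : ℕ) + 2 = d)
    (hl : (il : ℕ) + 1 = d) (hd : 3 ≤ d) :
    polyA41 d = convexHull ℝ (vertexSet i0 iq il) := by
  have h1 : (fun j : Fin d => if (j : ℕ) = d - 1 then (2 : ℝ) else if (j : ℕ) + 2 < d then 1 else 0)
      = topVertex iq il := by
    funext j
    have hj := j.isLt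
    by_cases a : j = il
    · have b : j ≠ iq := by rw [Ne, Fin.ext_iff] at *; omega
      have c : (j : ℕ) = d - 1 := by rw [a]; omega
      simp only [topVertex, if_pos a, if_neg b, if_pos c]
      norm_num
    · have c : (j : ℕ) ≠ d - 1 := by rw [Fin.ext_iff] at a; omega
      by_cases b : j = iq
      · have e : ¬ (j : ℕ) + 2 < d := by rw [b]; omega
        simp [topVertex, if_neg a, if_pos b, if_neg c, if_neg e]
      · have e : (j : ℕ) + 2 < d := by rw [Fin.ext_iff] at *; omega
        simp [topVertex, if_neg a, if_neg b, if_neg c, if_pos e]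
  have h2 : (fun j : Fin d => if (j : ℕ) = 0 then (1 : ℝ) else if (j : ℕ) = d - 2 then -1 else 0)
      = sideVertex i0 iq := by
    funext j
    have a : j = i0 ↔ (j : ℕ) = 0 := by rw [Fin.ext_iff, h0]
    have b : j = iq ↔ (j : ℕ) = d - 2 := by rw [Fin.ext_iff]; omega
    simp only [sideVertex, a, b]
    split_ifs <;> first | omega | norm_num
  have h3 : {x | ∃ j : Fin d, (j : ℕ) < d - 1 ∧ x = stdE d j} = stdE d '' {j | j ≠ il} := by
    ext x
    simp only [Set.mem_ofPred_eq, Set.mem_image, Ne, Fin.ext_iff]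
    exact exists_congr fun j => and_congr (by have := j.isLt; omega) eq_comm
  rw [polyA41, vertexSet, h1, h2, h3]

variable {i0 iq il : Fin d}

lemma vertexSet_finite : (vertexSet i0 iq il).Finite :=
  (by simp : Set.Finite {0, topVertex iq il, sideVertex i0 iq}).union ((Set.toFinite _).image _)

lemma forall_mem_vertexSet {p : (Fin d → ℝ) → Prop} :
    (∀ x ∈ vertexSet i0 iq il, p x) ↔ p 0 ∧ p (topVertex iq il) ∧ p (sideVertex i0 iq) ∧
      ∀ j, j ≠ il → p (stdE d j) := by
  simp only [vertexSet, Set.mem_union, Set.mem_insert_iff, Set.mem_singleton_iff, Set.mem_image,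
    Set.mem_ofPred_eq]
  constructor
  · intro h
    exact ⟨h _ (by simp), h _ (by simp), h _ (by simp), fun j hj => h _ (Or.inr ⟨j, hj, rfl⟩)⟩
  · rintro ⟨a, b, c, e⟩ x ((rfl | rfl | rfl) | ⟨j, hj, rfl⟩)
    exacts [a, b, c, e j hj]

lemma zero_mem_vertexSet : 0 ∈ vertexSet i0 iq il := by simp [vertexSet]

lemma topVertex_mem_vertexSet : topVertex iq il ∈ vertexSet i0 iq il := by simp [vertexSet]

lemma sideVertex_mem_vertexSet : sideVertex i0 iq ∈ vertexSet i0 iq il := by simp [vertexSet]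

lemma stdE_mem_vertexSet {j : Fin d} (hj : j ≠ il) : stdE d j ∈ vertexSet i0 iq il :=
  Or.inr ⟨j, hj, rfl⟩

lemma stdE_mem_latticePts (j : Fin d) : stdE d j ∈ latticePts d := fun i =>
  ⟨if i = j then 1 else 0, by simp [stdE]⟩

lemma vertexSet_subset_latticePts : vertexSet i0 iq il ⊆ latticePts d := by
  refine forall_mem_vertexSet.2 ⟨fun i => ⟨0, by simp⟩, fun i => ?_, fun i => ?_, fun j _ =>
    stdE_mem_latticePts j⟩
  · exact ⟨1 - (if i = iq then 1 else 0) + (if i = il then 1 else 0), by simp [topVertex]⟩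
  · exact ⟨(if i = i0 then 1 else 0) - (if i = iq then 1 else 0), by simp [sideVertex]⟩

lemma sum_topVertex : ∑ j, topVertex iq il j = d := by
  simp [topVertex, Finset.sum_add_distrib, Finset.sum_sub_distrib]

lemma sum_sideVertex : ∑ j, sideVertex i0 iq j = 0 := by
  simp [sideVertex, Finset.sum_sub_distrib]

lemma sum_stdE (j : Fin d) : ∑ i, stdE d j i = 1 := by simp [stdE]

lemma sum_smul_stdE (x : Fin d → ℝ) : ∑ j, x j • stdE d j = x := by
  ext i
  simp [stdE]

lemma stdE_injective : Function.Injective (stdE d) := by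
  intro i j h
  have := congrFun h i
  simpa [stdE] using this

lemma topVertex_eq_sum : topVertex iq il = ∑ j, stdE d j - stdE d iq + stdE d il := by
  ext i
  simp [topVertex, stdE]

lemma sideVertex_eq_sub : sideVertex i0 iq = stdE d i0 - stdE d iq := by
  ext i
  simp [sideVertex, stdE]

lemma convex_dilateIneq (n : ℝ) : Convex ℝ {x : Fin d → ℝ | DilateIneq i0 iq il n x} := by
  rintro x ⟨x1, x2, x3, x4, x5⟩ y ⟨y1, y2, y3, y4, y5⟩ a b ha hb hab
  have key {p q r s : ℝ} (h1 : p ≤ q) (h2 : r ≤ s) : a * p + b * r ≤ a * q + b * s :=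
    add_le_add (mul_le_mul_of_nonneg_left h1 ha) (mul_le_mul_of_nonneg_left h2 hb)
  have hn : 2 * n = a * (2 * n) + b * (2 * n) := by rw [← add_mul, hab, one_mul]
  have hsum : ∑ j, (a • x + b • y) j = a * ∑ j, x j + b * ∑ j, y j := by
    simp [Finset.sum_add_distrib, Finset.mul_sum]
  simp only [Set.mem_ofPred_eq, DilateIneq, hsum]
  simp only [Pi.add_apply, Pi.smul_apply, smul_eq_mul]
  refine ⟨by positivity, fun j hq hl => ?_, ?_, ?_, ?_⟩
  · linarith [key (x2 j hq hl) (y2 j hq hl)]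
  · linarith [key x3 y3]
  · linarith [key x4 y4]
  · linarith [key x5 y5]

lemma dilateIneq_of_mem_vertexSet (h0q : i0 ≠ iq) (h0l : i0 ≠ il) (hql : iq ≠ il) :
    ∀ x ∈ vertexSet i0 iq il, DilateIneq i0 iq il 1 x := by
  rw [forall_mem_vertexSet]
  refine ⟨by simp [DilateIneq], ?_, ?_, fun j hj => ?_⟩
  · simp only [DilateIneq, sum_topVertex]
    simp only [topVertex, if_true, if_neg h0q, if_neg h0l, if_neg hql, if_neg hql.symm]
    refine ⟨by norm_num, fun j h1 h2 => by simp [h1, h2]; norm_num, by norm_num, ?_, ?_⟩ <;>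
      ring_nf <;> norm_num
  · simp only [DilateIneq, sum_sideVertex]
    simp only [sideVertex, if_true, if_neg h0q, if_neg h0q.symm, if_neg h0l.symm, if_neg hql.symm]
    refine ⟨by norm_num, fun j h1 h2 => by simp [h1]; split_ifs <;> norm_num, by norm_num, ?_, ?_⟩
      <;> norm_num
  · simp only [DilateIneq, sum_stdE]
    simp only [stdE, if_neg hj.symm]
    refine ⟨le_rfl, fun i _ _ => ?_, ?_, ?_, ?_⟩ <;> (try split_ifs) <;> norm_num

lemma mem_convexHull_vertexSet_iff (h0q : i0 ≠ iq) (h0l : i0 ≠ il) (hql : iq ≠ il)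
    (x : Fin d → ℝ) :
    x ∈ convexHull ℝ (vertexSet i0 iq il) ↔ DilateIneq i0 iq il 1 x := by
  constructor
  · exact fun hx => convexHull_min (dilateIneq_of_mem_vertexSet h0q h0l hql)
      (convex_dilateIneq 1) hx
  · rintro ⟨hl, hj, h0, hA, hB⟩
    have hj0 := hj i0 h0q h0l
    obtain ⟨c, hc0, hcq, hc1, hc2⟩ : ∃ c : ℝ, 0 ≤ c ∧ 0 ≤ x iq + c ∧ x il ≤ 2 * x i0 - 2 * c ∧
        2 * ∑ j, x j - (d - 1) * x il + 2 * c ≤ 2 := by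
      rcases le_total 0 (x iq) with h | h
      · exact ⟨0, le_rfl, by linarith, by linarith, by linarith⟩
      · exact ⟨-x iq, by linarith, by linarith, by linarith, by linarith⟩
    let a : Fin d → ℝ := fun j => x j - x il / 2 + (if j = iq then x il / 2 + c else 0) -
      (if j = i0 then c else 0)
    have hsum : ∑ j, a j = ∑ j, x j - (d - 1) * x il / 2 := by
      simp [a, Finset.sum_add_distrib, Finset.sum_sub_distrib]
      ring
    let p : Fin d → Fin d → ℝ := fun j => if j = il then topVertex iq il else stdE d j
    have hp : ∀ j, p j ∈ vertexSet i0 iq il := by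
      intro j
      by_cases h : j = il
      · simp [p, h, topVertex_mem_vertexSet]
      · simp [p, h, stdE_mem_vertexSet h]
    have ha : ∀ j, 0 ≤ a j := by
      intro j
      by_cases h1 : j = iq
      · subst h1
        simp only [a, if_true, if_neg h0q.symm]
        linarith
      · by_cases h2 : j = i0
        · subst h2
          simp only [a, if_true, if_neg h1]
          linarith
        · simp only [a, if_neg h1, if_neg h2]
          by_cases h3 : j = il
          · subst h3; linarith
          · linarith [hj j h1 h3]
    have hcomb := (convex_convexHull ℝ (vertexSet i0 iq il)).sum_mem
      (t := (Finset.univ : Finset (Option (Option (Fin d)))))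
      (w := fun o => o.elim (1 - c - ∑ j, a j) fun o => o.elim c a)
      (z := fun o => o.elim 0 fun o => o.elim (sideVertex i0 iq) p) ?_ ?_ ?_
    · convert hcomb
      simp only [Fintype.sum_option, Option.elim, smul_zero, zero_add]
      have hpa : ∑ j, a j • p j = ∑ j, a j • stdE d j + a il • (topVertex iq il - stdE d il) := by
        rw [← Finset.sum_erase_add _ _ (Finset.mem_univ il),
          ← Finset.sum_erase_add _ (fun j => a j • stdE d j) (Finset.mem_univ il)]
        have : ∑ j ∈ Finset.univ.erase il, a j • p j =
            ∑ j ∈ Finset.univ.erase il, a j • stdE d j :=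
          Finset.sum_congr rfl fun j hj => by simp [p, Finset.ne_of_mem_erase hj]
        rw [this, smul_sub]
        simp only [p, if_true]
        abel
      rw [hpa, sum_smul_stdE]
      ext i
      have hal : a il = x il / 2 := by
        simp only [a, if_neg hql.symm, if_neg h0l.symm]; ring
      simp only [Pi.add_apply, Pi.smul_apply, Pi.sub_apply, smul_eq_mul, hal, sideVertex, topVertex,
        stdE, a]
      split_ifs <;> ring
    · rintro (_ | _ | j) -
      · simp only [Option.elim]; linarith
      · exact hc0
      · exact ha j
    · simp only [Fintype.sum_option, Option.elim]; ring
    · rintro (_ | _ | j) -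
      · exact subset_convexHull _ _ zero_mem_vertexSet
      · exact subset_convexHull _ _ sideVertex_mem_vertexSet
      · exact subset_convexHull _ _ (hp j)

lemma dilateIneq_inv_smul_iff {n : ℝ} (hn : 0 < n) (x : Fin d → ℝ) :
    DilateIneq i0 iq il 1 (n⁻¹ • x) ↔ DilateIneq i0 iq il n x := by
  have key (a b : ℝ) : n⁻¹ * a ≤ n⁻¹ * b ↔ a ≤ b := mul_le_mul_iff_right₀ (inv_pos.2 hn)
  simp only [DilateIneq, Pi.smul_apply, smul_eq_mul, ← Finset.mul_sum]
  have hn' : n⁻¹ * n = 1 := inv_mul_cancel₀ hn.ne'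
  refine and_congr ?_ (and_congr (forall_congr' fun j => forall_congr' fun _ =>
    forall_congr' fun _ => ?_) (and_congr ?_ (and_congr ?_ ?_)))
  · rw [← key 0 (x il), mul_zero]
  all_goals
    refine Iff.trans ?_ (key _ _)
    ring_nf
    try rw [mul_comm n, hn', one_mul]

lemma dilateIneq_intCast_iff (n : ℤ) (x : Fin d → ℤ) :
    DilateIneq i0 iq il (n : ℝ) (fun j => (x j : ℝ)) ↔ DilateIneq i0 iq il n x := by
  simp only [DilateIneq]
  norm_cast

lemma latticePts_eq_range :
    latticePts d = Set.range fun (z : Fin d → ℤ) (j : Fin d) => (z j : ℝ) := by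
  ext x
  constructor
  · intro h
    choose z hz using h
    exact ⟨z, funext fun j => (hz j).symm⟩
  · rintro ⟨z, rfl⟩ j
    exact ⟨z j, rfl⟩

lemma ehrhartCount_eq_ncard (h0q : i0 ≠ iq) (h0l : i0 ≠ il) (hql : iq ≠ il) {n : ℕ} (hn : 0 < n) :
    ehrhartCount (convexHull ℝ (vertexSet i0 iq il)) n =
      {x : Fin d → ℤ | DilateIneq i0 iq il (n : ℤ) x}.ncard := by
  have hn' : (0 : ℝ) < n := by exact_mod_cast hn
  have hinj : Function.Injective fun (z : Fin d → ℤ) (j : Fin d) => (z j : ℝ) := fun a b h =>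
    funext fun j => Int.cast_injective (congrFun h j)
  rw [ehrhartCount, ← Set.ncard_image_of_injective _ hinj, latticePts_eq_range]
  congr 1
  ext x
  simp only [Set.mem_inter_iff, Set.mem_range, Set.mem_image, Set.mem_ofPred_eq,
    Set.mem_smul_set_iff_inv_smul_mem₀ hn'.ne', mem_convexHull_vertexSet_iff h0q h0l hql,
    dilateIneq_inv_smul_iff hn']
  constructor
  · rintro ⟨⟨z, rfl⟩, h⟩
    exact ⟨z, (dilateIneq_intCast_iff _ _).1 (by exact_mod_cast h), rfl⟩
  · rintro ⟨z, h, rfl⟩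
    exact ⟨⟨z, rfl⟩, by exact_mod_cast (dilateIneq_intCast_iff _ _).2 h⟩

lemma extremePoints_convexHull_eq {S : Set (Fin d → ℝ)} (hS : S.Finite)
    (h : ∀ v ∈ S, ∃ f : (Fin d → ℝ) →ₗ[ℝ] ℝ, ∀ s ∈ S, s ≠ v → f s < f v) :
    (convexHull ℝ S).extremePoints ℝ = S := by
  refine extremePoints_convexHull_subset.antisymm fun v hv => ?_
  by_contra hne
  obtain ⟨f, hf⟩ := h v hv
  set T := (convexHull ℝ S).extremePoints ℝ
  have hTS : T ⊆ S := extremePoints_convexHull_subset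
  have hKM := closure_convexHull_extremePoints (hS.isCompact_convexHull ℝ) (convex_convexHull ℝ S)
  rw [((hS.subset hTS).isClosed_convexHull ℝ).closure_eq] at hKM
  have hvT : v ∈ convexHull ℝ T := hKM.symm ▸ subset_convexHull ℝ S hv
  have hlt : convexHull ℝ T ⊆ {x | f x < f v} :=
    convexHull_min (fun s hs => hf s (hTS hs) fun hsv => hne (hsv ▸ hs))
      (convex_halfSpace_lt f.isLinear _)
  exact lt_irrefl (f v) (hlt hvT)

lemma extremePoints_convexHull_vertexSet (h0q : i0 ≠ iq) (h0l : i0 ≠ il) (hql : iq ≠ il) :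
    (convexHull ℝ (vertexSet i0 iq il)).extremePoints ℝ = vertexSet i0 iq il := by
  have hqs := h0q.symm
  have hls := h0l.symm
  have hlq := hql.symm
  refine extremePoints_convexHull_eq vertexSet_finite ?_
  rw [forall_mem_vertexSet]
  let pr (j : Fin d) : (Fin d → ℝ) →ₗ[ℝ] ℝ := LinearMap.proj j
  have hd : (0 : ℝ) ≤ d := Nat.cast_nonneg d
  refine ⟨⟨-(pr i0) - ∑ j, pr j, ?_⟩, ⟨pr il, ?_⟩, ⟨pr i0 - (2 : ℝ) • pr iq, ?_⟩, fun j hj => ?_⟩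
  · rw [forall_mem_vertexSet]
    simp only [LinearMap.sub_apply, LinearMap.neg_apply, LinearMap.sum_apply, pr,
      LinearMap.proj_apply, sum_topVertex, sum_sideVertex, sum_stdE]
    refine ⟨by simp, fun _ => ?_, fun _ => ?_, fun i _ _ => ?_⟩
    · simp [topVertex, h0q, h0l]; linarith
    · simp [sideVertex, h0q]
    · simp [stdE]; split_ifs <;> norm_num
  · rw [forall_mem_vertexSet]
    simp only [pr, LinearMap.proj_apply]
    refine ⟨fun _ => ?_, by simp, fun _ => ?_, fun i hi _ => ?_⟩
    · simp [topVertex, hlq]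
    · simp [topVertex, sideVertex, hlq, hls]
    · simp [topVertex, stdE, hlq, hi.symm]
  · rw [forall_mem_vertexSet]
    simp only [pr, LinearMap.sub_apply, LinearMap.smul_apply, LinearMap.proj_apply, smul_eq_mul]
    refine ⟨fun _ => ?_, fun _ => ?_, by simp, fun i _ _ => ?_⟩
    · simp [sideVertex, h0q, hqs]; norm_num
    · simp [topVertex, sideVertex, h0q, h0l, hql, hqs]
    · simp only [sideVertex, stdE, if_neg h0q, if_neg hqs, if_true]
      split_ifs <;> norm_num
  · by_cases h1 : j = i0
    · subst h1
      refine ⟨(2 : ℝ) • pr j + pr iq - (2 : ℝ) • pr il, ?_⟩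
      rw [forall_mem_vertexSet]
      simp only [pr, LinearMap.sub_apply, LinearMap.add_apply, LinearMap.smul_apply,
        LinearMap.proj_apply, smul_eq_mul]
      refine ⟨fun _ => ?_, fun _ => ?_, fun _ => ?_, fun i hi hij => ?_⟩
      · simp [stdE, hqs, hls]
      · simp [stdE, topVertex, hqs, hls, h0q, h0l, hql, hlq]
      · simp [stdE, sideVertex, hqs, hls, h0q, hlq]
      · have : j ≠ i := fun h => hij (by rw [h])
        simp only [stdE, if_neg this, if_neg hi.symm, if_neg hqs, if_neg hls, if_true]
        split_ifs <;> norm_num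
    by_cases h2 : j = iq
    · subst h2
      refine ⟨pr j - pr i0, ?_⟩
      rw [forall_mem_vertexSet]
      simp only [pr, LinearMap.sub_apply, LinearMap.proj_apply]
      refine ⟨fun _ => ?_, fun _ => ?_, fun _ => ?_, fun i hi hij => ?_⟩
      · simp [stdE, h0q]
      · simp [stdE, topVertex, h0q, h0l, hql]
      · simp [stdE, sideVertex, hqs, h0q]; norm_num
      · have : j ≠ i := fun h => hij (by rw [h])
        simp only [stdE, if_neg this, if_neg h0q, if_true]
        split_ifs <;> norm_num
    · refine ⟨(2 : ℝ) • pr j - pr il, ?_⟩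
      rw [forall_mem_vertexSet]
      simp only [pr, LinearMap.sub_apply, LinearMap.smul_apply, LinearMap.proj_apply, smul_eq_mul]
      refine ⟨fun _ => ?_, fun _ => ?_, fun _ => ?_, fun i hi hij => ?_⟩
      · simp [stdE, hj.symm]
      · simp [stdE, topVertex, hj.symm, hlq, h2, hj]
      · simp [stdE, sideVertex, hj.symm, hls, hlq, h1, h2]
      · have : j ≠ i := fun h => hij (by rw [h])
        simp [stdE, this, hj.symm, hi.symm]

lemma ncard_vertexSet (h0q : i0 ≠ iq) (h0l : i0 ≠ il) (hql : iq ≠ il) :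
    (vertexSet i0 iq il).ncard = d + 2 := by
  have htop : topVertex iq il il = 2 := by simp [topVertex, hql.symm]; norm_num
  have hside : sideVertex i0 iq il = 0 := by simp [sideVertex, hql.symm, h0l.symm]
  have hsideq : sideVertex i0 iq iq = -1 := by simp [sideVertex, h0q.symm]
  have h01 : (0 : Fin d → ℝ) ≠ topVertex iq il := fun h => by
    have := congrFun h il
    simp [htop] at this
  have h02 : (0 : Fin d → ℝ) ≠ sideVertex i0 iq := fun h => by
    have := congrFun h iq
    simp [hsideq] at this
  have h12 : topVertex iq il ≠ sideVertex i0 iq := fun h => by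
    have := congrFun h il
    simp [htop, hside] at this
  have hdisj : Disjoint ({0, topVertex iq il, sideVertex i0 iq} : Set (Fin d → ℝ))
      (stdE d '' {j | j ≠ il}) := by
    rw [Set.disjoint_right]
    rintro _ ⟨j, hj, rfl⟩ (h | h | h)
    · have := congrFun h j
      simp [stdE] at this
    · have := congrFun h il
      rw [htop] at this
      simp only [stdE] at this
      split_ifs at this <;> norm_num at this
    · have := congrFun h iq
      rw [hsideq] at this
      simp only [stdE] at this
      split_ifs at this <;> norm_num at this
  have hthree : ({0, topVertex iq il, sideVertex i0 iq} : Set (Fin d → ℝ)).ncard = 3 := by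
    rw [Set.ncard_eq_three]
    exact ⟨_, _, _, h01, h02, h12, rfl⟩
  have himg : (stdE d '' {j | j ≠ il}).ncard = d - 1 := by
    rw [Set.ncard_image_of_injective _ stdE_injective]
    have : {j | j ≠ il} = ((Finset.univ.erase il : Finset (Fin d)) : Set (Fin d)) := by
      ext; simp
    rw [this, Set.ncard_coe_finset, Finset.card_erase_of_mem (Finset.mem_univ _)]
    simp
  rw [vertexSet, Set.ncard_union_eq hdisj (by simp) ((Set.toFinite _).image _), hthree, himg]
  have := il.pos
  omega

lemma affineSpan_convexHull_vertexSet (hql : iq ≠ il) :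
    affineSpan ℝ (convexHull ℝ (vertexSet i0 iq il)) = ⊤ := by
  rw [affineSpan_convexHull]
  set A := affineSpan ℝ (vertexSet i0 iq il)
  have hmem : ∀ v ∈ vertexSet i0 iq il, v ∈ A.direction := by
    intro v hv
    simpa using AffineSubspace.vsub_mem_direction (subset_affineSpan ℝ _ hv)
      (subset_affineSpan ℝ _ (zero_mem_vertexSet (i0 := i0) (iq := iq) (il := il)))
  rw [← AffineSubspace.direction_eq_top_iff_of_nonempty
    ⟨0, subset_affineSpan ℝ _ zero_mem_vertexSet⟩, eq_top_iff]
  have hE : ∀ j, stdE d j ∈ A.direction := by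
    intro j
    by_cases hj : j = il
    · subst hj
      have htop := hmem _ (topVertex_mem_vertexSet (i0 := i0) (iq := iq) (il := j))
      have hsum : ∑ i ∈ Finset.univ.erase j, stdE d i ∈ A.direction :=
        Submodule.sum_mem _ fun i hi => hmem _ (stdE_mem_vertexSet (Finset.ne_of_mem_erase hi))
      have hq := hmem _ (stdE_mem_vertexSet (i0 := i0) (iq := iq) hql)
      have : stdE d j = (2 : ℝ)⁻¹ • (topVertex iq j - ∑ i ∈ Finset.univ.erase j, stdE d i +
          stdE d iq) := by
        rw [topVertex_eq_sum, ← Finset.sum_erase_add _ _ (Finset.mem_univ j)]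
        module
      rw [this]
      exact Submodule.smul_mem _ _ (Submodule.add_mem _ (Submodule.sub_mem _ htop hsum) hq)
    · exact hmem _ (stdE_mem_vertexSet hj)
  intro x _
  rw [← sum_smul_stdE x]
  exact Submodule.sum_mem _ fun j _ => Submodule.smul_mem _ _ (hE j)

lemma not_isSimplex_of_lt_ncard {P : Set (Fin d → ℝ)} (h : d + 1 < (P.extremePoints ℝ).ncard) :
    ¬ IsSimplex P := by
  rintro ⟨n, v, hv, rfl⟩
  have h1 : ((convexHull ℝ (Set.range v)).extremePoints ℝ).ncard ≤ (Set.range v).ncard :=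
    Set.ncard_le_ncard extremePoints_convexHull_subset (Set.finite_range v)
  have h2 : (Set.range v).ncard ≤ n + 1 := by
    rw [← Set.image_univ]
    exact (Set.ncard_image_le Set.finite_univ).trans (by simp [Set.ncard_univ])
  have h3 := hv.card_le_finrank_succ
  have h4 := Submodule.finrank_le (vectorSpan ℝ (Set.range v))
  simp only [Fintype.card_fin, Module.finrank_fin_fun] at h3 h4
  omega

lemma mem_pyramidOver_last {e : ℕ} {Q : Set (Fin e → ℝ)} {y : Fin (e + 1) → ℝ}
    (hy : y ∈ pyramidOver Q) : 0 ≤ y (Fin.last e) ∧ y (Fin.last e) ≤ 1 ∧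
      (y (Fin.last e) = 1 → y = Fin.snoc (α := fun _ => ℝ) (0 : Fin e → ℝ) (1 : ℝ)) := by
  set t : Fin (e + 1) → ℝ := Fin.snoc (α := fun _ => ℝ) (0 : Fin e → ℝ) (1 : ℝ)
  have hconv : Convex ℝ {y : Fin (e + 1) → ℝ |
      0 ≤ y (Fin.last e) ∧ y (Fin.last e) ≤ 1 ∧ (y (Fin.last e) = 1 → y = t)} := by
    rintro x ⟨hx0, hx1, hx⟩ y ⟨hy0, hy1, hy⟩ a b ha hb hab
    simp only [Set.mem_ofPred_eq, Pi.add_apply, Pi.smul_apply, smul_eq_mul]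
    refine ⟨by positivity, by nlinarith, fun h => ?_⟩
    rcases ha.eq_or_lt with rfl | ha'
    · obtain rfl : b = 1 := by linarith
      simp only [zero_mul, one_mul, zero_add] at h
      simp [hy h]
    rcases hb.eq_or_lt with rfl | hb'
    · obtain rfl : a = 1 := by linarith
      simp only [zero_mul, one_mul, add_zero] at h
      simp [hx h]
    have hx' : x (Fin.last e) = 1 := by nlinarith
    have hy' : y (Fin.last e) = 1 := by nlinarith
    rw [hx hx', hy hy', ← add_smul, hab, one_smul]
  refine convexHull_min ?_ hconv hy
  rintro y (⟨q, -, rfl⟩ | rfl)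
  · simp
  · simp [t]

lemma not_isLatticePyramid (h0q : i0 ≠ iq) (h0l : i0 ≠ il) (hql : iq ≠ il) :
    ¬ IsLatticePyramid (convexHull ℝ (vertexSet i0 iq il)) := by
  rintro ⟨e, Q, -, -, f, hf, himg⟩
  rw [affineSpan_convexHull_vertexSet hql] at hf
  have hlat : ∀ x ∈ latticePts d, ∃ z : ℤ, f x (Fin.last e) = z := fun x hx =>
    (hf.mapsTo ⟨hx, trivial⟩).1 (Fin.last e)
  set V := vertexSet i0 iq il
  have hPyr : ∀ x ∈ convexHull ℝ V, f x ∈ pyramidOver Q := fun x hx =>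
    himg ▸ Set.mem_image_of_mem f hx
  set g : (Fin d → ℝ) →ᵃ[ℝ] ℝ :=
    (LinearMap.proj (Fin.last e) : (Fin (e + 1) → ℝ) →ₗ[ℝ] ℝ).toAffineMap.comp f
  have hgf (x) : g x = f x (Fin.last e) := rfl
  have hg01 : ∀ v ∈ V, g v = 0 ∨ g v = 1 := by
    intro v hv
    obtain ⟨h0, h1, -⟩ := mem_pyramidOver_last (hPyr v (subset_convexHull ℝ V hv))
    obtain ⟨z, hz⟩ := hlat v (vertexSet_subset_latticePts hv)
    rw [hgf, hz]
    rw [hz] at h0 h1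
    have h0' : 0 ≤ z := by exact_mod_cast h0
    have h1' : z ≤ 1 := by exact_mod_cast h1
    interval_cases z <;> simp
  obtain ⟨v, hv, hgv⟩ : ∃ v ∈ V, g v = 1 := by
    by_contra! hne
    have hsub : convexHull ℝ V ⊆ g ⁻¹' {0} :=
      convexHull_min (fun v hv => (hg01 v hv).resolve_right (hne v hv))
        ((convex_singleton (0 : ℝ)).affine_preimage g)
    have hapex : Fin.snoc (α := fun _ => ℝ) (0 : Fin e → ℝ) (1 : ℝ) ∈ pyramidOver Q :=
      subset_convexHull ℝ _ (Or.inr rfl)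
    rw [← himg] at hapex
    obtain ⟨x, hx, hfx⟩ := hapex
    have h0 : g x = 0 := hsub hx
    rw [hgf, hfx] at h0
    simp at h0
  have hg : ∀ s ∈ V, s ≠ v → g s = 0 := by
    intro s hs hsv
    refine (hg01 s hs).resolve_right fun h1 => hsv ?_
    refine hf.injOn ⟨vertexSet_subset_latticePts hs, trivial⟩
      ⟨vertexSet_subset_latticePts hv, trivial⟩ ?_
    rw [(mem_pyramidOver_last (hPyr s (subset_convexHull ℝ V hs))).2.2 h1,
      (mem_pyramidOver_last (hPyr v (subset_convexHull ℝ V hv))).2.2 hgv]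
  have hlin (x) : g x = g.linear x + g 0 := congrFun g.decomp x
  have hEmem {j} (hj : j ≠ il) : stdE d j ∈ V := stdE_mem_vertexSet hj
  have h0V : (0 : Fin d → ℝ) ∈ V := zero_mem_vertexSet
  have htV : topVertex iq il ∈ V := topVertex_mem_vertexSet
  have hsV : sideVertex i0 iq ∈ V := sideVertex_mem_vertexSet
  have hrel : g (sideVertex i0 iq) = g (stdE d i0) - g (stdE d iq) + g 0 := by
    rw [hlin, hlin (stdE d i0), hlin (stdE d iq), sideVertex_eq_sub, map_sub]
    ring
  have hne0 {a b : Fin d → ℝ} (i : Fin d) (h : a i ≠ b i) : a ≠ b := fun hab => h (hab ▸ rfl)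
  have hg0 : g 0 = 0 ∧ g (stdE d iq) = 0 := by
    have n1 : stdE d i0 ≠ 0 := hne0 i0 (by simp [stdE])
    have n2 : stdE d iq ≠ 0 := hne0 iq (by simp [stdE])
    have n3 : sideVertex i0 iq ≠ 0 := hne0 i0 (by simp [sideVertex, h0q])
    have n4 : stdE d i0 ≠ stdE d iq := fun h => h0q (stdE_injective h)
    have n5 : sideVertex i0 iq ≠ stdE d iq := hne0 i0 (by simp [sideVertex, stdE, h0q])
    by_cases c1 : 0 = v
    · subst c1
      have := hg _ (hEmem h0l) n1
      have := hg _ (hEmem hql) n2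
      have := hg _ hsV n3
      linarith
    by_cases c2 : stdE d iq = v
    · subst c2
      have := hg _ (hEmem h0l) n4
      have := hg _ h0V c1
      have := hg _ hsV n5
      linarith
    exact ⟨hg _ h0V c1, hg _ (hEmem hql) c2⟩
  obtain ⟨hg0, hgq⟩ := hg0
  obtain ⟨z, hz⟩ := hlat (stdE d il) (stdE_mem_latticePts il)
  rw [← hgf] at hz
  have hlin' (x) : g x = g.linear x := by rw [hlin, hg0, add_zero]
  have htop : g (topVertex iq il) = ∑ j ∈ Finset.univ.erase il, g (stdE d j) + 2 * z := by
    rw [hlin', topVertex_eq_sum, map_add, map_sub, map_sum,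
      ← Finset.sum_erase_add _ _ (Finset.mem_univ il)]
    simp only [← hlin', hgq, hz]
    ring
  by_cases c : topVertex iq il = v
  · have hzero : ∑ j ∈ Finset.univ.erase il, g (stdE d j) = 0 := by
      refine Finset.sum_eq_zero fun j hj => hg _ (hEmem (Finset.ne_of_mem_erase hj)) ?_
      rw [← c]
      refine hne0 il ?_
      simp only [stdE, if_neg (Finset.ne_of_mem_erase hj).symm, topVertex, if_neg hql.symm, if_true]
      norm_num
    rw [c, hgv, hzero] at htop
    have : (1 : ℤ) = 0 + 2 * z := by exact_mod_cast htop
    omega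
  · rw [hg _ htV c] at htop
    obtain ⟨j, hj, rfl⟩ : ∃ j, j ≠ il ∧ stdE d j = v := by
      rcases hv with (rfl | rfl | rfl) | ⟨j, hj, rfl⟩
      · linarith
      · exact absurd rfl c
      · have h1 := hg _ (hEmem h0l) (hne0 iq (by simp [sideVertex, stdE, h0q.symm]))
        linarith
      · exact ⟨j, hj, rfl⟩
    have hone : ∑ i ∈ Finset.univ.erase il, g (stdE d i) = 1 := by
      rw [Finset.sum_eq_single_of_mem j (Finset.mem_erase.2 ⟨hj, Finset.mem_univ _⟩), hgv]
      exact fun i hi hij =>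
        hg _ (hEmem (Finset.ne_of_mem_erase hi)) fun h => hij (stdE_injective h)
    rw [hone] at htop
    have : (0 : ℤ) = 1 + 2 * z := by exact_mod_cast htop
    omega

lemma not_spansLattice {k : ℕ} (hk : 2 ≤ k) (hd : d = 2 * k) (h0q : i0 ≠ iq) (h0l : i0 ≠ il)
    (hql : iq ≠ il) : ¬ SpansLattice (convexHull ℝ (vertexSet i0 iq il)) := by
  intro h
  let ev : (Fin (d + 1) → ℤ) →+ ℤ := Pi.evalAddMonoidHom (fun _ => ℤ) il.castSucc
  have hle : AddSubgroup.closure {y : Fin (d + 1) → ℤ | y (Fin.last d) = 1 ∧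
      (fun i : Fin d => (y i.castSucc : ℝ)) ∈ convexHull ℝ (vertexSet i0 iq il)} ≤
      (AddSubgroup.zmultiples (2 : ℤ)).comap ev := by
    rw [AddSubgroup.closure_le]
    rintro y ⟨-, hy⟩
    rw [mem_convexHull_vertexSet_iff h0q h0l hql] at hy
    have hy' := (dilateIneq_intCast_iff 1 fun i => y i.castSucc).1 (by exact_mod_cast hy)
    obtain ⟨ε, hε, σ, -, z, hz, hzy⟩ :=
      exists_dilateParam (n := 1) hd h0q h0l hql (by exact_mod_cast hy')
    have hε0 : ε = 0 := by
      interval_cases ε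
      · rfl
      · omega
    have hl := congrFun hzy il
    simp only [dilateParam, if_neg hql.symm, if_neg h0l.symm, hε0] at hl
    change y il.castSucc ∈ AddSubgroup.zmultiples (2 : ℤ)
    rw [Int.mem_zmultiples_iff]
    omega
  have hone : (fun _ => 1 : Fin (d + 1) → ℤ) ∈ (AddSubgroup.zmultiples (2 : ℤ)).comap ev :=
    hle (h ▸ AddSubgroup.mem_top _)
  change (1 : ℤ) ∈ AddSubgroup.zmultiples (2 : ℤ) at hone
  rw [Int.mem_zmultiples_iff] at hone
  omega

end Polytope

/-- properties of `A⁽⁴⁾₁` for `d = 2k`, `k ≥ 2`. -/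
theorem polyA41_properties (k : ℕ) (hk : 2 ≤ k) (d : ℕ) (hd : d = 2 * k) :
    IsLatticePolytope (polyA41 d) ∧
    affineSpan ℝ (polyA41 d) = ⊤ ∧
    ((polyA41 d).extremePoints ℝ).ncard = d + 2 ∧
    ¬ IsSimplex (polyA41 d) ∧
    ¬ IsLatticePyramid (polyA41 d) ∧
    HasDeltaPoly (polyA41 d) (1 + X + X ^ k + X ^ (k + 1)) ∧
    ((1 + X + X ^ k + X ^ (k + 1) : Polynomial ℤ).eval 1 = 4) ∧
    ¬ SpansLattice (polyA41 d) := by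
  obtain ⟨i0, h0⟩ : ∃ i : Fin d, (i : ℕ) = 0 := ⟨⟨0, by omega⟩, rfl⟩
  obtain ⟨iq, hq⟩ : ∃ i : Fin d, (i : ℕ) + 2 = d := ⟨⟨d - 2, by omega⟩, by simp; omega⟩
  obtain ⟨il, hl⟩ : ∃ i : Fin d, (i : ℕ) + 1 = d := ⟨⟨d - 1, by omega⟩, by simp; omega⟩
  have h0q : i0 ≠ iq := by rw [Ne, Fin.ext_iff]; omega
  have h0l : i0 ≠ il := by rw [Ne, Fin.ext_iff]; omega
  have hql : iq ≠ il := by rw [Ne, Fin.ext_iff]; omega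
  rw [polyA41_eq_convexHull h0 hq hl (by omega)]
  have hext : ((convexHull ℝ (vertexSet i0 iq il)).extremePoints ℝ).ncard = d + 2 := by
    rw [extremePoints_convexHull_vertexSet h0q h0l hql, ncard_vertexSet h0q h0l hql]
  refine ⟨⟨(vertexSet_finite (i0 := i0) (iq := iq) (il := il)).toFinset, ?_, ?_⟩,
    affineSpan_convexHull_vertexSet hql, hext,
    not_isSimplex_of_lt_ncard (by omega), not_isLatticePyramid h0q h0l hql,
    hasDeltaPoly_of_count (by omega) fun n hn => ?_, by norm_num,
    not_spansLattice hk hd h0q h0l hql⟩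
  · rw [Set.Finite.coe_toFinset]
    exact vertexSet_subset_latticePts
  · rw [Set.Finite.coe_toFinset]
  · rw [ehrhartCount_eq_ncard h0q h0l hql hn, ncard_dilateIneq hd h0q h0l hql]
end
end

section
/- Let k ≥ 2 and d = 2k, and let B^(4) = conv{0, e_1, …, e_{d−1}, Σ_{j=1}^{d−2} e_j + 2e_d, −e_1 + e_{d−1}} ⊂ ℝ^d. Then B^(4) is a lattice polytope of dimension d with exactly d + 2 vertices which is not a simplex and not a lattice pyramid, its δ-polynomial equals 1 + t + 2t^k (so Vol(B^(4)) = 4), and ℤ((B^(4), 1) ∩ ℤ^{d+1}) ≠ ℤ^{d+1}. -/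
open Pointwise Polynomial

noncomputable section

namespace PolyB4

/-- The index of the coordinate `x_{d-1}` for `d = m + 4`. -/
def idxQ (m : ℕ) : Fin (m + 4) := ⟨m + 2, by omega⟩

/-- The index of the last coordinate `x_d` for `d = m + 4`. -/
def idxL (m : ℕ) : Fin (m + 4) := ⟨m + 3, by omega⟩

/-- The indices of the coordinates `x_2, …, x_{d-2}` for `d = m + 4`. -/
def mid (m : ℕ) : Finset (Fin (m + 4)) :=
  Finset.univ.filter fun j => 0 < (j : ℕ) ∧ (j : ℕ) < m + 2

lemma mem_mid {m : ℕ} {j : Fin (m + 4)} : j ∈ mid m ↔ 0 < (j : ℕ) ∧ (j : ℕ) < m + 2 := by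
  simp [mid]

lemma card_mid (m : ℕ) : (mid m).card = m + 1 := by
  have : mid m = Finset.univ.image fun i : Fin (m + 1) => (⟨i + 1, by omega⟩ : Fin (m + 4)) := by
    ext j
    simp only [mem_mid, Finset.mem_image, Finset.mem_univ, true_and, Fin.ext_iff]
    constructor
    · rintro ⟨h1, h2⟩
      exact ⟨⟨j - 1, by omega⟩, by simp; omega⟩
    · rintro ⟨i, hi⟩
      have := i.2
      omega
  rw [this, Finset.card_image_of_injective _ (fun a b h => by simpa [Fin.ext_iff] using h)]
  simp

lemma idx_cases {m : ℕ} (j : Fin (m + 4)) : j = 0 ∨ j = idxQ m ∨ j = idxL m ∨ j ∈ mid m := by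
  simp only [mem_mid, Fin.ext_iff, idxQ, idxL, Fin.val_zero]
  omega

lemma idxQ_ne_zero (m : ℕ) : idxQ m ≠ 0 := by simp [idxQ, Fin.ext_iff]
lemma idxL_ne_zero (m : ℕ) : idxL m ≠ 0 := by simp [idxL, Fin.ext_iff]
lemma idxQ_ne_idxL (m : ℕ) : idxQ m ≠ idxL m := by simp [idxL, idxQ, Fin.ext_iff]
lemma zero_notMem_mid (m : ℕ) : (0 : Fin (m + 4)) ∉ mid m := by simp [mem_mid]
lemma idxQ_notMem_mid (m : ℕ) : idxQ m ∉ mid m := by simp [mem_mid, idxQ]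
lemma idxL_notMem_mid (m : ℕ) : idxL m ∉ mid m := by simp [mem_mid, idxL]

lemma ne_of_mem_mid {m : ℕ} {j : Fin (m + 4)} (hj : j ∈ mid m) :
    j ≠ 0 ∧ j ≠ idxQ m ∧ j ≠ idxL m :=
  ⟨fun h => zero_notMem_mid m (h ▸ hj), fun h => idxQ_notMem_mid m (h ▸ hj),
    fun h => idxL_notMem_mid m (h ▸ hj)⟩

/-- The vertex `Σ_{j ≤ d-2} e_j + 2 e_d`. -/
def apexW (m : ℕ) : Fin (m + 4) → ℝ :=
  fun j => if j = idxL m then 2 else if j = idxQ m then 0 else 1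

/-- The vertex `-e_1 + e_{d-1}`. -/
def vertU (m : ℕ) : Fin (m + 4) → ℝ :=
  fun j => if j = 0 then -1 else if j = idxQ m then 1 else 0

/-- The vertex set of the polytope. -/
def verts (m : ℕ) : Set (Fin (m + 4) → ℝ) :=
  {0, apexW m, vertU m, stdE _ 0, stdE _ (idxQ m)} ∪ stdE _ '' (mid m : Set (Fin (m + 4)))

lemma polyB4_eq (m : ℕ) : polyB4 (m + 4) = convexHull ℝ (verts m) := by
  have hw : (fun j : Fin (m + 4) => if (j : ℕ) = m + 4 - 1 then (2 : ℝ)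
      else if (j : ℕ) + 2 < m + 4 then 1 else 0) = apexW m := by
    funext j
    simp only [apexW, Fin.ext_iff, idxL, idxQ]
    split_ifs <;> first | rfl | omega
  have hu : (fun j : Fin (m + 4) => if (j : ℕ) = 0 then (-1 : ℝ)
      else if (j : ℕ) = m + 4 - 2 then 1 else 0) = vertU m := by
    funext j
    simp only [vertU, Fin.ext_iff, idxQ, Fin.val_zero]
    split_ifs <;> first | rfl | omega
  rw [polyB4, hw, hu, verts]
  congr 1
  ext x
  simp only [Set.mem_union, Set.mem_insert_iff, Set.mem_singleton_iff, Set.mem_ofPred_eq,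
    Set.mem_image, Finset.mem_coe]
  constructor
  · rintro (h | ⟨j, hj, rfl⟩)
    · tauto
    · rcases idx_cases j with rfl | rfl | rfl | h
      · tauto
      · tauto
      · simp [idxL] at hj
      · exact Or.inr ⟨j, h, rfl⟩
  · rintro ((h | h | h | h | h) | ⟨j, hj, rfl⟩)
    · tauto
    · tauto
    · tauto
    · exact Or.inr ⟨0, by simp, h⟩
    · exact Or.inr ⟨idxQ m, by simp [idxQ], h⟩
    · have := mem_mid.1 hj
      exact Or.inr ⟨j, by omega, rfl⟩

lemma verts_induction {m : ℕ} {p : (Fin (m + 4) → ℝ) → Prop} (h0 : p 0) (hw : p (apexW m))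
    (hu : p (vertU m)) (he : p (stdE _ 0)) (hq : p (stdE _ (idxQ m)))
    (hm : ∀ j ∈ mid m, p (stdE _ j)) : ∀ v ∈ verts m, p v := by
  rintro v ((rfl | rfl | rfl | rfl | rfl) | ⟨j, hj, rfl⟩)
  exacts [h0, hw, hu, he, hq, hm j hj]

lemma finite_verts (m : ℕ) : (verts m).Finite :=
  (Set.toFinite _).union ((Finset.finite_toSet _).image _)

/-- The linear form that is `0` on the four vertices of the square face and `2` on all
other vertices. -/
def level (m : ℕ) : (Fin (m + 4) → ℝ) →ₗ[ℝ] ℝ :=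
  LinearMap.proj (idxL m) +
    ∑ j ∈ mid m, ((2 : ℝ) • LinearMap.proj j - LinearMap.proj (idxL m))

lemma level_apply {m : ℕ} (x : Fin (m + 4) → ℝ) :
    level m x = x (idxL m) + ∑ j ∈ mid m, (2 * x j - x (idxL m)) := by
  simp [level]

section values

variable (m : ℕ)

@[simp] lemma apexW_zero : apexW m 0 = 1 := by
  simp [apexW, (idxL_ne_zero m).symm, (idxQ_ne_zero m).symm]
@[simp] lemma apexW_idxQ : apexW m (idxQ m) = 0 := by simp [apexW, idxQ_ne_idxL]
@[simp] lemma apexW_idxL : apexW m (idxL m) = 2 := by simp [apexW]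
lemma apexW_mid {j : Fin (m + 4)} (hj : j ∈ mid m) : apexW m j = 1 := by
  simp [apexW, (ne_of_mem_mid hj)]
@[simp] lemma vertU_zero : vertU m 0 = -1 := by simp [vertU]
@[simp] lemma vertU_idxQ : vertU m (idxQ m) = 1 := by simp [vertU, idxQ_ne_zero]
@[simp] lemma vertU_idxL : vertU m (idxL m) = 0 := by
  simp [vertU, idxL_ne_zero, (idxQ_ne_idxL m).symm]
lemma vertU_mid {j : Fin (m + 4)} (hj : j ∈ mid m) : vertU m j = 0 := by
  simp [vertU, (ne_of_mem_mid hj)]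

@[simp] lemma stdE_self {d : ℕ} (j : Fin d) : stdE d j j = 1 := by simp [stdE]
lemma stdE_of_ne {d : ℕ} {i j : Fin d} (h : i ≠ j) : stdE d j i = 0 := by simp [stdE, h]

@[simp] lemma stdE_zero_idxQ : stdE _ 0 (idxQ m) = 0 := stdE_of_ne (idxQ_ne_zero m)
@[simp] lemma stdE_zero_idxL : stdE _ 0 (idxL m) = 0 := stdE_of_ne (idxL_ne_zero m)
@[simp] lemma stdE_idxQ_zero : stdE _ (idxQ m) 0 = 0 := stdE_of_ne (idxQ_ne_zero m).symm
@[simp] lemma stdE_idxQ_idxL : stdE _ (idxQ m) (idxL m) = 0 :=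
  stdE_of_ne (idxQ_ne_idxL m).symm

@[simp] lemma level_apexW : level m (apexW m) = 2 := by
  rw [level_apply, Finset.sum_eq_zero fun j hj => by rw [apexW_mid m hj, apexW_idxL]; norm_num]
  simp
@[simp] lemma level_vertU : level m (vertU m) = 0 := by
  rw [level_apply, Finset.sum_eq_zero fun j hj => by rw [vertU_mid m hj, vertU_idxL]; norm_num]
  simp
lemma level_stdE_of_notMem {i : Fin (m + 4)} (hi : i ∉ mid m) (hL : i ≠ idxL m) :
    level m (stdE _ i) = 0 := by
  rw [level_apply, Finset.sum_eq_zero fun j hj => by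
    rw [stdE_of_ne (fun h : j = i => hi (h ▸ hj)), stdE_of_ne hL.symm]; norm_num]
  simp [stdE_of_ne hL.symm]
@[simp] lemma level_stdE_zero : level m (stdE _ 0) = 0 :=
  level_stdE_of_notMem m (zero_notMem_mid m) (idxL_ne_zero m).symm
@[simp] lemma level_stdE_idxQ : level m (stdE _ (idxQ m)) = 0 :=
  level_stdE_of_notMem m (idxQ_notMem_mid m) (idxQ_ne_idxL m)
lemma level_stdE_mid {i : Fin (m + 4)} (hi : i ∈ mid m) : level m (stdE _ i) = 2 := by
  have hL := stdE_of_ne (ne_of_mem_mid hi).2.2.symm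
  rw [level_apply, hL, Finset.sum_eq_single_of_mem i hi fun j _ h => by rw [stdE_of_ne h]; norm_num]
  simp

end values

/-- The facet inequalities of the `n`-th dilate of the polytope. -/
structure InDilate (m : ℕ) (n : ℝ) (x : Fin (m + 4) → ℝ) : Prop where
  last_nonneg : 0 ≤ x (idxL m)
  mid_le : ∀ j ∈ mid m, x (idxL m) ≤ 2 * x j
  q_nonneg : 0 ≤ x (idxQ m)
  r_nonneg : 0 ≤ 2 * x 0 + 2 * x (idxQ m) - x (idxL m)
  q_le : 2 * x (idxQ m) + level m x ≤ 2 * n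
  r_le : 2 * x 0 + 2 * x (idxQ m) - x (idxL m) + level m x ≤ 2 * n

lemma InDilate.add {m : ℕ} {a b : ℝ} {x y : Fin (m + 4) → ℝ} (hx : InDilate m a x)
    (hy : InDilate m b y) : InDilate m (a + b) (x + y) := by
  obtain ⟨h1, h2, h3, h4, h5, h6⟩ := hx
  obtain ⟨g1, g2, g3, g4, g5, g6⟩ := hy
  constructor <;> simp only [Pi.add_apply, map_add]
  · linarith
  · intro j hj
    linarith [h2 j hj, g2 j hj]
  all_goals linarith

lemma InDilate.smul {m : ℕ} {a c : ℝ} {x : Fin (m + 4) → ℝ} (hc : 0 ≤ c) (hx : InDilate m a x) :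
    InDilate m (c * a) (c • x) := by
  obtain ⟨h1, h2, h3, h4, h5, h6⟩ := hx
  constructor <;> simp only [Pi.smul_apply, map_smul, smul_eq_mul]
  · positivity
  · intro j hj
    nlinarith [h2 j hj]
  · positivity
  all_goals nlinarith

lemma inDilate_of_mem_verts {m : ℕ} : ∀ v ∈ verts m, InDilate m 1 v := by
  apply verts_induction
  · constructor <;> simp
  · constructor <;> simp +contextual [apexW_mid]
  · constructor <;> simp +contextual [vertU_mid]
  · constructor <;> simp +contextual
    intro j hj
    rw [stdE_of_ne (ne_of_mem_mid hj).1]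
  · constructor <;> simp +contextual
    intro j hj
    rw [stdE_of_ne (ne_of_mem_mid hj).2.1]
  · intro i hi
    have h0 := stdE_of_ne (ne_of_mem_mid hi).1.symm
    have hQ := stdE_of_ne (ne_of_mem_mid hi).2.1.symm
    have hL := stdE_of_ne (ne_of_mem_mid hi).2.2.symm
    constructor <;> simp [h0, hQ, hL, level_stdE_mid m hi]
    intro j hj
    simp only [stdE]
    split_ifs <;> norm_num

lemma sum_smul_mem {ι E : Type*} [AddCommGroup E] [Module ℝ E] {P : Set E} (hP : Convex ℝ P)
    (hne : P.Nonempty) (t : Finset ι) (a : ι → ℝ) (z : ι → E) (ha : ∀ i ∈ t, 0 ≤ a i)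
    (hz : ∀ i ∈ t, z i ∈ P) : ∑ i ∈ t, a i • z i ∈ (∑ i ∈ t, a i) • P := by
  classical
  induction t using Finset.induction_on with
  | empty => simp [Set.zero_smul_set hne]
  | insert i t hi ih =>
    rw [Finset.sum_insert hi, Finset.sum_insert hi, hP.add_smul (ha i (by simp))
      (Finset.sum_nonneg fun j hj => ha j (by simp [hj]))]
    exact Set.add_mem_add (Set.smul_mem_smul_set (hz i (by simp)))
      (ih (fun j hj => ha j (by simp [hj])) (fun j hj => hz j (by simp [hj])))

lemma verts_subset (m : ℕ) : verts m ⊆ polyB4 (m + 4) := by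
  rw [polyB4_eq]
  exact subset_convexHull ℝ _

lemma mem_smul_polyB4_iff {m : ℕ} {n : ℝ} (hn : 0 ≤ n) {x : Fin (m + 4) → ℝ} :
    x ∈ n • polyB4 (m + 4) ↔ InDilate m n x := by
  constructor
  · rintro ⟨y, hy, rfl⟩
    have hc : Convex ℝ {y | InDilate m 1 y} := by
      intro y hy z hz a b ha hb hab
      have := (InDilate.smul ha hy).add (InDilate.smul hb hz)
      rwa [mul_one, mul_one, hab] at this
    rw [polyB4_eq] at hy
    have : InDilate m 1 y := convexHull_min inDilate_of_mem_verts hc hy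
    simpa using this.smul hn
  · intro h
    have hP : Convex ℝ (polyB4 (m + 4)) := convex_convexHull ℝ _
    have hv := verts_subset m
    have h0 : (0 : Fin (m + 4) → ℝ) ∈ polyB4 (m + 4) := hv (by simp [verts])
    have key : ∀ {a b : ℝ} {y z : Fin (m + 4) → ℝ}, 0 ≤ b → 0 ≤ a → y ∈ a • polyB4 (m + 4) →
        z ∈ polyB4 (m + 4) → y + b • z ∈ (a + b) • polyB4 (m + 4) := by
      intro a b y z hb ha hy hz
      rw [hP.add_smul ha hb]
      exact Set.add_mem_add hy (Set.smul_mem_smul_set hz)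
    obtain ⟨h1, h2, h3, h4, h5, h6⟩ := h
    set q := x (idxQ m) with hq
    set l := x (idxL m) with hl
    set r := x 0 + q - l / 2 with hr
    set s := n - level m x / 2 with hs
    set g := min q r with hg
    have hgq : g ≤ q := min_le_left _ _
    have hgr : g ≤ r := min_le_right _ _
    have hg0 : 0 ≤ g := le_min h3 (by linarith)
    have hgs : 0 ≤ s - q - r + g := by
      rcases min_cases q r with ⟨h, -⟩ | ⟨h, -⟩ <;> rw [← hg] at h <;> linarith
    have hsum0 : 0 ≤ ∑ j ∈ mid m, (x j - l / 2) :=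
      Finset.sum_nonneg fun j hj => by linarith [h2 j hj]
    have m1 := sum_smul_mem hP ⟨0, h0⟩ (mid m) (fun j => x j - l / 2) (fun j => stdE _ j)
      (fun j hj => by linarith [h2 j hj])
      (fun j hj => hv (Or.inr ⟨j, hj, rfl⟩))
    have m2 := key (b := l / 2) (by linarith) hsum0 m1 (hv (show apexW m ∈ _ by simp [verts]))
    have m3 := key (b := q - g) (by linarith) (by linarith) m2
      (hv (show vertU m ∈ _ by simp [verts]))
    have m4 := key (b := r - g) (by linarith) (by linarith) m3
      (hv (show stdE _ 0 ∈ _ by simp [verts]))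
    have m5 := key (b := g) (by linarith) (by linarith) m4
      (hv (show stdE _ (idxQ m) ∈ _ by simp [verts]))
    have m6 := key (b := s - q - r + g) hgs (by linarith) m5 h0
    have e1 : ∑ j ∈ mid m, (x j - l / 2) + l / 2 + (q - g) + (r - g) + g + (s - q - r + g) = n := by
      have : level m x = l + 2 * ∑ j ∈ mid m, (x j - l / 2) := by
        rw [level_apply, Finset.mul_sum]
        congr 1
        exact Finset.sum_congr rfl fun j _ => by ring
      rw [hs, this]
      ring
    rw [e1] at m6
    convert m6 using 1
    funext i
    simp only [Pi.add_apply, Finset.sum_apply, Pi.smul_apply, smul_eq_mul, Pi.zero_apply, mul_zero,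
      add_zero]
    have hsum : ∀ i, i ∉ mid m → ∑ j ∈ mid m, (x j - l / 2) * stdE (m + 4) j i = 0 := fun i hi =>
      Finset.sum_eq_zero fun j hj => by rw [stdE_of_ne (fun h : i = j => hi (h ▸ hj)), mul_zero]
    rcases idx_cases i with rfl | rfl | rfl | hi
    · rw [hsum _ (zero_notMem_mid m)]
      simp
      linarith
    · rw [hsum _ (idxQ_notMem_mid m)]
      simp
      linarith
    · rw [hsum _ (idxL_notMem_mid m)]
      simp
      linarith
    · rw [Finset.sum_eq_single_of_mem i hi fun j _ h => by rw [stdE_of_ne h.symm, mul_zero],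
        apexW_mid m hi, vertU_mid m hi, stdE_of_ne (ne_of_mem_mid hi).1,
        stdE_of_ne (ne_of_mem_mid hi).2.1]
      simp

lemma verts_subset_latticePts (m : ℕ) : verts m ⊆ latticePts (m + 4) := by
  have hE : ∀ j : Fin (m + 4), stdE _ j ∈ latticePts (m + 4) := fun j i => by
    by_cases h : i = j
    · exact ⟨1, by simp [stdE, h]⟩
    · exact ⟨0, by simp [stdE, h]⟩
  refine verts_induction (fun i => ⟨0, by simp⟩) (fun i => ?_) (fun i => ?_) (hE _) (hE _)
    fun j _ => hE j
  · unfold apexW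
    split_ifs
    exacts [⟨2, by simp⟩, ⟨0, by simp⟩, ⟨1, by simp⟩]
  · unfold vertU
    split_ifs
    exacts [⟨-1, by simp⟩, ⟨1, by simp⟩, ⟨0, by simp⟩]

lemma isLatticePolytope_polyB4 (m : ℕ) : IsLatticePolytope (polyB4 (m + 4)) := by
  refine ⟨(finite_verts m).toFinset, ?_, by rw [Set.Finite.coe_toFinset, polyB4_eq]⟩
  rw [Set.Finite.coe_toFinset]
  exact verts_subset_latticePts m

lemma sum_stdE {d : ℕ} (x : Fin d → ℝ) : x = ∑ j, x j • stdE d j := by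
  funext i
  simp [stdE]

/-- `2 e_d` in terms of the vertices. -/
lemma two_smul_stdE_idxL (m : ℕ) :
    (2 : ℝ) • stdE _ (idxL m) = apexW m - stdE _ 0 - ∑ j ∈ mid m, stdE _ j := by
  funext i
  have hsum : ∀ i, i ∉ mid m → ∑ j ∈ mid m, stdE (m + 4) j i = 0 := fun i hi =>
    Finset.sum_eq_zero fun j hj => stdE_of_ne (fun h : i = j => hi (h ▸ hj))
  simp only [Pi.sub_apply, Finset.sum_apply, Pi.smul_apply, smul_eq_mul]
  rcases idx_cases i with rfl | rfl | rfl | hi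
  · rw [hsum _ (zero_notMem_mid m), stdE_of_ne (idxL_ne_zero m).symm]
    simp
  · rw [hsum _ (idxQ_notMem_mid m), stdE_of_ne (idxQ_ne_idxL m)]
    simp
  · rw [hsum _ (idxL_notMem_mid m)]
    simp
  · rw [Finset.sum_eq_single_of_mem i hi fun j _ h => stdE_of_ne h.symm, apexW_mid m hi,
      stdE_of_ne (ne_of_mem_mid hi).1, stdE_of_ne (ne_of_mem_mid hi).2.2]
    simp

lemma affineSpan_polyB4 (m : ℕ) : affineSpan ℝ (polyB4 (m + 4)) = ⊤ := by
  have h0 : (0 : Fin (m + 4) → ℝ) ∈ polyB4 (m + 4) := verts_subset m (by simp [verts])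
  rw [AffineSubspace.affineSpan_eq_top_iff_vectorSpan_eq_top_of_nonempty ℝ _ _ ⟨0, h0⟩,
    eq_top_iff]
  have hv : ∀ v ∈ verts m, v ∈ vectorSpan ℝ (polyB4 (m + 4)) := fun v hv => by
    simpa using vsub_mem_vectorSpan ℝ (verts_subset m hv) h0
  have h1 : stdE _ 0 ∈ vectorSpan ℝ (polyB4 (m + 4)) := hv _ (by simp [verts])
  have h2 : stdE _ (idxQ m) ∈ vectorSpan ℝ (polyB4 (m + 4)) := hv _ (by simp [verts])
  have h3 : ∀ j ∈ mid m, stdE _ j ∈ vectorSpan ℝ (polyB4 (m + 4)) :=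
    fun j hj => hv _ (Or.inr ⟨j, hj, rfl⟩)
  have h4 : stdE _ (idxL m) ∈ vectorSpan ℝ (polyB4 (m + 4)) := by
    rw [← Submodule.smul_mem_iff _ (two_ne_zero (α := ℝ)), two_smul_stdE_idxL]
    exact sub_mem (sub_mem (hv _ (by simp [verts])) h1) (sum_mem h3)
  intro x _
  rw [sum_stdE x]
  refine sum_mem fun j _ => Submodule.smul_mem _ _ ?_
  rcases idx_cases j with rfl | rfl | rfl | hj
  exacts [h1, h2, h4, h3 j hj]

lemma mem_extremePoints_of_forall_lt {E : Type*} [AddCommGroup E] [Module ℝ E] {V : Set E} {v : E}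
    (hv : v ∈ V) (f : E →ₗ[ℝ] ℝ) (hf : ∀ w ∈ V, w = v ∨ f v < f w) :
    v ∈ (convexHull ℝ V).extremePoints ℝ := by
  have hc : Convex ℝ {w | w = v ∨ f v < f w} := by
    rw [convex_iff_forall_pos]
    rintro x hx y hy a b ha hb hab
    by_cases hxy : x = v ∧ y = v
    · exact Or.inl (by rw [hxy.1, hxy.2, ← add_smul, hab, one_smul])
    · right
      rw [map_add, map_smul, map_smul, smul_eq_mul, smul_eq_mul]
      obtain rfl : b = 1 - a := by linarith
      rcases hx with rfl | hx <;> rcases hy with rfl | hy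
      · simp at hxy
      all_goals nlinarith
  have hs : ∀ w ∈ convexHull ℝ V, w = v ∨ f v < f w := fun w hw => convexHull_min hf hc hw
  refine ⟨subset_convexHull ℝ V hv, fun x hx y hy hxy => ?_⟩
  obtain ⟨a, b, ha, hb, hab, hxy⟩ := hxy
  have := congrArg f hxy
  rw [map_add, map_smul, map_smul, smul_eq_mul, smul_eq_mul] at this
  rcases hs x hx with h | h
  · exact h
  · have hy' : f v ≤ f y := by
      rcases hs y hy with h | h
      · rw [h]
      · exact h.le
    obtain rfl : b = 1 - a := by linarith
    nlinarith

lemma extremePoints_polyB4 (m : ℕ) : (polyB4 (m + 4)).extremePoints ℝ = verts m := by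
  rw [polyB4_eq]
  refine (extremePoints_convexHull_subset).antisymm ?_
  have hz : ∀ j ∈ mid m, stdE (m + 4) j 0 = 0 :=
    fun j hj => stdE_of_ne (ne_of_mem_mid hj).1.symm
  have hQ : ∀ j ∈ mid m, stdE (m + 4) j (idxQ m) = 0 :=
    fun j hj => stdE_of_ne (ne_of_mem_mid hj).2.1.symm
  have hL : ∀ j ∈ mid m, stdE (m + 4) j (idxL m) = 0 :=
    fun j hj => stdE_of_ne (ne_of_mem_mid hj).2.2.symm
  let r : (Fin (m + 4) → ℝ) →ₗ[ℝ] ℝ :=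
    (2 : ℝ) • LinearMap.proj 0 + (2 : ℝ) • LinearMap.proj (idxQ m) - LinearMap.proj (idxL m)
  have hr : ∀ x, r x = 2 * x 0 + 2 * x (idxQ m) - x (idxL m) := fun x => by simp [r]
  let q : (Fin (m + 4) → ℝ) →ₗ[ℝ] ℝ := LinearMap.proj (idxQ m)
  have hq : ∀ x, q x = x (idxQ m) := fun x => rfl
  apply verts_induction
  · refine mem_extremePoints_of_forall_lt (by simp [verts]) (level m + q + r) ?_
    apply verts_induction <;>
      (simp +contextual [hr, hq, level_stdE_mid, hz, hQ, hL]; try norm_num)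
  · refine mem_extremePoints_of_forall_lt (by simp [verts]) (-LinearMap.proj (idxL m)) ?_
    apply verts_induction <;> simp +contextual [hL]
  · refine mem_extremePoints_of_forall_lt (by simp [verts]) (level m - (2 : ℝ) • q + r) ?_
    apply verts_induction <;> simp +contextual [hr, hq, level_stdE_mid, hz, hQ, hL]
  · refine mem_extremePoints_of_forall_lt (by simp [verts]) (level m + (2 : ℝ) • q - r) ?_
    apply verts_induction <;> simp +contextual [hr, hq, level_stdE_mid, hz, hQ, hL]
  · refine mem_extremePoints_of_forall_lt (by simp [verts]) (level m - (2 : ℝ) • q - r) ?_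
    apply verts_induction <;>
      simp +contextual [hr, hq, level_stdE_mid, hz, hQ, hL] <;> norm_num
  · intro j hj
    refine mem_extremePoints_of_forall_lt (Or.inr ⟨j, hj, rfl⟩)
      (LinearMap.proj (idxL m) - (2 : ℝ) • LinearMap.proj j) ?_
    have hj' := ne_of_mem_mid hj
    apply verts_induction
    · right; simp [hL j hj]
    · right; simp [hL j hj, apexW_mid m hj]
    · right; simp [hL j hj, vertU_mid m hj]
    · right; simp [hL j hj, stdE_of_ne hj'.1]
    · right; simp [hL j hj, stdE_of_ne hj'.2.1]
    · intro i hi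
      by_cases h : j = i
      · exact Or.inl (by rw [h])
      · right; simp [hL j hj, hL i hi, stdE_of_ne h]

lemma stdE_injective (d : ℕ) : Function.Injective (stdE d) := fun i j h => by
  by_contra hij
  simpa [stdE_of_ne hij] using congrFun h i

lemma ncard_verts (m : ℕ) : (verts m).ncard = m + 4 + 2 := by
  have hd : Disjoint ({0, apexW m, vertU m, stdE _ 0, stdE _ (idxQ m)} : Set (Fin (m + 4) → ℝ))
      (stdE _ '' (mid m : Set (Fin (m + 4)))) := by
    rw [Set.disjoint_right]
    rintro _ ⟨j, hj, rfl⟩ h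
    have hj' := ne_of_mem_mid hj
    have h1 := stdE_self j
    rcases h with h | h | h | h | h
    · rw [h] at h1
      simp at h1
    · simpa [stdE_of_ne hj'.2.2.symm] using congrFun h (idxL m)
    · rw [h, vertU_mid m hj] at h1
      simp at h1
    · exact hj'.1 (stdE_injective _ h)
    · exact hj'.2.1 (stdE_injective _ h)
  have hne : ∀ {x y : Fin (m + 4) → ℝ} (i), x i ≠ y i → x ≠ y := fun i h e => h (e ▸ rfl)
  rw [verts, Set.ncard_union_eq hd (Set.toFinite _) ((Finset.finite_toSet _).image _),
    Set.ncard_image_of_injective _ (stdE_injective _), Set.ncard_coe_finset, card_mid,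
    Set.ncard_insert_of_notMem, Set.ncard_insert_of_notMem, Set.ncard_insert_of_notMem,
    Set.ncard_pair]
  · omega
  · exact hne 0 (by simp)
  · rintro (h | h)
    · exact hne 0 (by simp; norm_num) h
    · exact hne 0 (by simp) h
  · rintro (h | h | h)
    · exact hne (idxL m) (by simp) h
    · exact hne (idxL m) (by simp) h
    · exact hne (idxL m) (by simp) h
  · rintro (h | h | h | h)
    · exact hne (idxL m) (by simp) h
    · exact hne 0 (by simp) h
    · exact hne 0 (by simp) h
    · exact hne (idxQ m) (by simp) h

lemma not_isSimplex_polyB4 (m : ℕ) : ¬ IsSimplex (polyB4 (m + 4)) := by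
  rintro ⟨n, v, hv, hP⟩
  have h1 : verts m ⊆ Set.range v := by
    rw [← extremePoints_polyB4, hP]
    exact extremePoints_convexHull_subset
  have h2 := Set.ncard_le_ncard h1 (Set.finite_range v)
  have h3 : (Set.range v).ncard = n + 1 := by
    rw [← Set.image_univ, Set.ncard_image_of_injective _ hv.injective, Set.ncard_univ]
    simp
  have h4 := hv.card_le_finrank_succ
  have h5 := Submodule.finrank_le (vectorSpan ℝ (Set.range v))
  rw [ncard_verts, h3] at h2
  simp at h4 h5
  omega

lemma pyramidOver_last {e : ℕ} {Q : Set (Fin e → ℝ)} {y : Fin (e + 1) → ℝ}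
    (hy : y ∈ pyramidOver Q) : 0 ≤ y (Fin.last e) ∧ y (Fin.last e) ≤ 1 ∧
      (y (Fin.last e) = 1 → y = Fin.snoc (0 : Fin e → ℝ) (1 : ℝ)) := by
  have hc : Convex ℝ {y : Fin (e + 1) → ℝ | 0 ≤ y (Fin.last e) ∧ y (Fin.last e) ≤ 1 ∧
      (y (Fin.last e) = 1 → y = Fin.snoc (0 : Fin e → ℝ) (1 : ℝ))} := by
    rw [convex_iff_forall_pos]
    rintro x ⟨hx0, hx1, hx⟩ y ⟨hy0, hy1, hy⟩ a b ha hb hab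
    obtain rfl : b = 1 - a := by linarith
    refine ⟨?_, ?_, fun h => ?_⟩
    · simp only [Pi.add_apply, Pi.smul_apply, smul_eq_mul]
      positivity
    · simp only [Pi.add_apply, Pi.smul_apply, smul_eq_mul]
      nlinarith
    · simp only [Pi.add_apply, Pi.smul_apply, smul_eq_mul] at h
      rw [hx (by nlinarith), hy (by nlinarith), ← add_smul, hab, one_smul]
  refine convexHull_min ?_ hc hy
  rintro _ (⟨x, -, rfl⟩ | rfl) <;> simp

lemma not_isLatticePyramid_polyB4 (m : ℕ) : ¬ IsLatticePyramid (polyB4 (m + 4)) := by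
  rintro ⟨e, Q, -, -, f, hf, hfP⟩
  rw [affineSpan_polyB4, AffineSubspace.top_coe, Set.inter_univ] at hf
  set H : (Fin (m + 4) → ℝ) →ₗ[ℝ] ℝ := (LinearMap.proj (Fin.last e)).comp f.linear with hH
  set c : ℝ := f 0 (Fin.last e) with hc
  have hh : ∀ x, f x (Fin.last e) = H x + c := fun x => by
    rw [show f x = f.linear x + f 0 from congrFun f.decomp x]
    rfl
  have hInt : ∀ x ∈ latticePts (m + 4), ∃ z : ℤ, H x + c = z := fun x hx => by
    rw [← hh]
    exact (hf.mapsTo hx).1 _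
  have hpyr : ∀ x ∈ verts m, f x ∈ pyramidOver Q := fun x hx =>
    hfP ▸ Set.mem_image_of_mem f (verts_subset m hx)
  obtain ⟨v, hv, hv1⟩ : ∃ v ∈ verts m, 1 ≤ H v + c := by
    by_contra! hlt
    have hsub : polyB4 (m + 4) ⊆ {x | H x < 1 - c} := by
      rw [polyB4_eq]
      refine convexHull_min (fun v hv => ?_) (convex_halfSpace_lt H.isLinear _)
      have := hlt v hv
      change H v < 1 - c
      linarith
    have hap : (Fin.snoc (0 : Fin e → ℝ) (1 : ℝ) : Fin (e + 1) → ℝ) ∈ f '' polyB4 (m + 4) := by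
      rw [hfP]
      exact subset_convexHull ℝ _ (by simp)
    obtain ⟨x, hx, hfx⟩ := hap
    have h1 := hh x
    rw [hfx, Fin.snoc_last] at h1
    have h2 : H x < 1 - c := hsub hx
    linarith
  have hv1' : H v + c = 1 := le_antisymm (hh v ▸ (pyramidOver_last (hpyr v hv)).2.1) hv1
  have hother : ∀ w ∈ verts m, w ≠ v → H w + c = 0 := by
    intro w hw hwv
    obtain ⟨h0, h1, h2⟩ := pyramidOver_last (hpyr w hw)
    have h3 := (pyramidOver_last (hpyr v hv)).2.2
    rw [hh] at h0 h1 h2 h3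
    have hne : H w + c ≠ 1 := fun h =>
      hwv (hf.injOn (verts_subset_latticePts m hw) (verts_subset_latticePts m hv)
        ((h2 h).trans (h3 hv1').symm))
    obtain ⟨z, hz⟩ := hInt w (verts_subset_latticePts m hw)
    rw [hz] at h0 h1 hne ⊢
    norm_cast at h0 h1 hne ⊢
    omega
  have hsquare : H (vertU m) = H (stdE _ (idxQ m)) - H (stdE _ 0) := by
    rw [← map_sub]
    congr 1
    funext i
    simp only [vertU, stdE, Pi.sub_apply]
    split_ifs with h1 h2
    · exact absurd (h2.symm.trans h1) (idxQ_ne_zero m)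
    all_goals norm_num
  have hapex : 2 * H (stdE _ (idxL m)) =
      H (apexW m) - H (stdE _ 0) - ∑ j ∈ mid m, H (stdE _ j) := by
    rw [← smul_eq_mul, ← map_smul, two_smul_stdE_idxL, map_sub, map_sub, map_sum]
  have h0 : H 0 = 0 := map_zero H
  have hne : ∀ {x y : Fin (m + 4) → ℝ} (i), x i ≠ y i → x ≠ y := fun i h e => h (e ▸ rfl)
  have mem0 : (0 : Fin (m + 4) → ℝ) ∈ verts m := by simp [verts]
  have memW : apexW m ∈ verts m := by simp [verts]
  have memU : vertU m ∈ verts m := by simp [verts]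
  have memE : stdE _ 0 ∈ verts m := by simp [verts]
  have memQ : stdE _ (idxQ m) ∈ verts m := by simp [verts]
  have memM : ∀ j ∈ mid m, stdE _ j ∈ verts m := fun j hj => Or.inr ⟨j, hj, rfl⟩
  obtain ⟨z, hz⟩ := hInt (stdE _ (idxL m)) fun i => by
    by_cases h : i = idxL m
    · exact ⟨1, by simp [stdE, h]⟩
    · exact ⟨0, by simp [stdE, h]⟩
  have odd_absurd : ∀ z : ℤ, (2 : ℝ) * z ≠ 1 ∧ (2 : ℝ) * z ≠ -1 := fun z => by
    constructor <;> norm_cast <;> omega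
  rcases hv with (rfl | rfl | rfl | rfl | rfl) | ⟨j, hj, rfl⟩
  · have h1 := hother _ memU (hne (idxQ m) (by simp))
    have h2 := hother _ memE (hne 0 (by simp))
    have h3 := hother _ memQ (hne (idxQ m) (by simp))
    linarith
  · have hW : ∀ x : Fin (m + 4) → ℝ, x (idxL m) = 0 → x ≠ apexW m :=
      fun x hx => hne (idxL m) (by simp [hx])
    have h1 := hother _ mem0 (hW _ (by simp))
    have h2 := hother _ memE (hW _ (by simp))
    have h3 : ∑ j ∈ mid m, H (stdE _ j) = 0 := Finset.sum_eq_zero fun j hj => by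
      have := hother _ (memM j hj) (hW _ (stdE_of_ne (ne_of_mem_mid hj).2.2.symm))
      linarith
    exact (odd_absurd z).1 (by linarith)
  · have h1 := hother _ mem0 (hne (idxQ m) (by simp))
    have h2 := hother _ memE (hne (idxQ m) (by simp))
    have h3 := hother _ memQ (hne 0 (by simp))
    linarith
  · have h1 := hother _ mem0 (hne 0 (by simp))
    have h2 := hother _ memU (hne (idxQ m) (by simp))
    have h3 := hother _ memQ (hne 0 (by simp))
    linarith
  · have h1 := hother _ mem0 (hne (idxQ m) (by simp))
    have h2 := hother _ memU (hne 0 (by simp))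
    have h3 := hother _ memE (hne 0 (by simp))
    linarith
  · have hj' := ne_of_mem_mid hj
    have hM : ∀ x : Fin (m + 4) → ℝ, x j = 0 → x ≠ stdE _ j :=
      fun x hx => hne j (by simp [hx])
    have h1 := hother _ mem0 (hM _ (by simp))
    have h2 := hother _ memE (hM _ (stdE_of_ne hj'.1))
    have h3 := hother _ memW (hne (idxL m) (by simp [stdE_of_ne hj'.2.2.symm]))
    have h4 : ∑ i ∈ mid m, H (stdE _ i) = H (stdE _ j) :=
      Finset.sum_eq_single_of_mem j hj fun i hi h => by
        have := hother _ (memM i hi) (hM _ (stdE_of_ne h.symm))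
        linarith
    exact (odd_absurd z).2 (by linarith)


/-- The indices of the tuples parametrizing lattice points. -/
def tupleIdx (m : ℕ) : Finset (Fin (m + 4)) := insert (idxL m) (insert (idxQ m) (mid m))

lemma sum_tupleIdx {m : ℕ} {M : Type*} [AddCommMonoid M] (l : Fin (m + 4) → M) :
    ∑ j ∈ tupleIdx m, l j = l (idxL m) + (l (idxQ m) + ∑ j ∈ mid m, l j) := by
  rw [tupleIdx, Finset.sum_insert, Finset.sum_insert (idxQ_notMem_mid m)]
  simp [(idxQ_ne_idxL m).symm, idxL_notMem_mid]

/-- Parameters of the lattice points with `x_d ≡ ε (mod 2)`. -/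
def params (m ε N : ℕ) : Finset (Σ _ : Fin (m + 4) →₀ ℕ, ℕ × ℕ) :=
  (Finset.finsuppAntidiag (tupleIdx m) N).sigma fun l =>
    Finset.range (l (idxQ m) + 1 + ε) ×ˢ Finset.range (l (idxQ m) + 1)

lemma mem_params {m ε N : ℕ} {p : Σ _ : Fin (m + 4) →₀ ℕ, ℕ × ℕ} :
    p ∈ params m ε N ↔ (p.1 (idxL m) + (p.1 (idxQ m) + ∑ j ∈ mid m, p.1 j) = N ∧ p.1 0 = 0) ∧
      p.2.1 < p.1 (idxQ m) + 1 + ε ∧ p.2.2 < p.1 (idxQ m) + 1 := by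
  have hsupp : p.1.support ⊆ tupleIdx m ↔ p.1 0 = 0 := by
    constructor
    · intro h
      by_contra h0
      have := h (Finsupp.mem_support_iff.2 h0)
      simp [tupleIdx, (idxL_ne_zero m).symm, (idxQ_ne_zero m).symm, zero_notMem_mid] at this
    · intro h j hj
      rcases idx_cases j with rfl | rfl | rfl | hj'
      · exact absurd h (Finsupp.mem_support_iff.1 hj)
      all_goals simp_all [tupleIdx]
  simp only [params, Finset.mem_sigma, Finset.mem_finsuppAntidiag, Finset.mem_product,
    Finset.mem_range, hsupp, sum_tupleIdx]

/-- The lattice point with given parameters. -/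
def latPt (m ε : ℕ) (p : Σ _ : Fin (m + 4) →₀ ℕ, ℕ × ℕ) : Fin (m + 4) → ℝ := fun j =>
  if j = idxL m then 2 * p.1 (idxL m) + ε
  else if j = idxQ m then p.2.1
  else if j = 0 then p.2.2 - p.2.1 + p.1 (idxL m) + ε
  else p.1 j + p.1 (idxL m) + ε

section latPt

variable (m ε : ℕ) (p : Σ _ : Fin (m + 4) →₀ ℕ, ℕ × ℕ)

lemma latPt_idxL : latPt m ε p (idxL m) = 2 * p.1 (idxL m) + ε := by simp [latPt]
lemma latPt_idxQ : latPt m ε p (idxQ m) = p.2.1 := by simp [latPt, idxQ_ne_idxL]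
lemma latPt_zero : latPt m ε p 0 = p.2.2 - p.2.1 + p.1 (idxL m) + ε := by
  simp [latPt, (idxL_ne_zero m).symm, (idxQ_ne_zero m).symm]
lemma latPt_mid {j : Fin (m + 4)} (hj : j ∈ mid m) :
    latPt m ε p j = p.1 j + p.1 (idxL m) + ε := by
  simp [latPt, ne_of_mem_mid hj]

lemma latPt_mem_latticePts : latPt m ε p ∈ latticePts (m + 4) := by
  intro j
  unfold latPt
  split_ifs
  exacts [⟨2 * p.1 (idxL m) + ε, by push_cast; rfl⟩, ⟨p.2.1, by simp⟩,
    ⟨p.2.2 - p.2.1 + p.1 (idxL m) + ε, by push_cast; rfl⟩,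
    ⟨p.1 j + p.1 (idxL m) + ε, by push_cast; rfl⟩]

lemma level_latPt : level m (latPt m ε p) =
    2 * p.1 (idxL m) + 2 * ∑ j ∈ mid m, (p.1 j : ℝ) + ε * (m + 2) := by
  rw [level_apply, latPt_idxL, Finset.sum_congr rfl (g := fun j => 2 * (p.1 j : ℝ) + ε)
    fun j hj => by rw [latPt_mid m ε p hj]; ring, Finset.sum_add_distrib, ← Finset.mul_sum,
    Finset.sum_const, card_mid, nsmul_eq_mul]
  push_cast
  ring

end latPt

lemma latPt_injOn (m ε N : ℕ) : Set.InjOn (latPt m ε) (params m ε N) := by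
  rintro ⟨l, q, r⟩ hp ⟨l', q', r'⟩ hp' h
  obtain ⟨⟨hs, h0⟩, -⟩ := mem_params.1 hp
  obtain ⟨⟨hs', h0'⟩, -⟩ := mem_params.1 hp'
  have hL := congrFun h (idxL m)
  have hQ := congrFun h (idxQ m)
  have hz := congrFun h 0
  rw [latPt_idxL, latPt_idxL] at hL
  rw [latPt_idxQ, latPt_idxQ] at hQ
  rw [latPt_zero, latPt_zero] at hz
  simp only at hL hQ hz hs hs' h0 h0'
  have eL : l (idxL m) = l' (idxL m) := by exact_mod_cast (by linarith : (l (idxL m) : ℝ) = l' (idxL m))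
  have eq : q = q' := by exact_mod_cast hQ
  subst eq
  have er : r = r' := by
    rw [eL] at hz
    exact_mod_cast (by linarith : (r : ℝ) = r')
  have em : ∀ j ∈ mid m, l j = l' j := fun j hj => by
    have hj' := congrFun h j
    rw [latPt_mid _ _ _ hj, latPt_mid _ _ _ hj] at hj'
    simp only [eL] at hj'
    exact_mod_cast (by linarith : (l j : ℝ) = l' j)
  have hsum : ∑ j ∈ mid m, l j = ∑ j ∈ mid m, l' j := Finset.sum_congr rfl em
  have : l = l' := by
    ext j
    rcases idx_cases j with rfl | rfl | rfl | hj
    exacts [h0.trans h0'.symm, by omega, eL, em j hj]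
  rw [this, er]

lemma latPt_mem_smul {m k ε N n : ℕ} (hk : m + 4 = 2 * k) (hN : N + ε * k = n)
    {p : Σ _ : Fin (m + 4) →₀ ℕ, ℕ × ℕ} (hp : p ∈ params m ε N) :
    latPt m ε p ∈ (n : ℝ) • polyB4 (m + 4) := by
  obtain ⟨⟨hs, -⟩, hq, hr⟩ := mem_params.1 hp
  have hs' : (p.1 (idxL m) : ℝ) + (p.1 (idxQ m) + ∑ j ∈ mid m, (p.1 j : ℝ)) = N := by
    exact_mod_cast hs
  have hq' : (p.2.1 : ℝ) ≤ p.1 (idxQ m) + ε := by exact_mod_cast (by omega)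
  have hr' : (p.2.2 : ℝ) ≤ p.1 (idxQ m) := by exact_mod_cast (by omega)
  have hn : (2 * n : ℝ) = 2 * N + ε * (m + 4) := by
    rw [show (m + 4 : ℝ) = 2 * k by exact_mod_cast hk, ← hN]
    push_cast
    ring
  have hε : (0 : ℝ) ≤ ε := Nat.cast_nonneg _
  rw [mem_smul_polyB4_iff (Nat.cast_nonneg n)]
  constructor
  · rw [latPt_idxL]
    positivity
  · intro j hj
    rw [latPt_idxL, latPt_mid _ _ _ hj]
    have : (0 : ℝ) ≤ p.1 j := Nat.cast_nonneg _
    linarith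
  · rw [latPt_idxQ]
    positivity
  · rw [latPt_zero, latPt_idxL, latPt_idxQ]
    have : (0 : ℝ) ≤ p.2.2 := Nat.cast_nonneg _
    linarith
  · rw [latPt_idxQ, level_latPt]
    linarith
  · rw [latPt_zero, latPt_idxL, latPt_idxQ, level_latPt]
    linarith

lemma exists_latPt_eq {m k n : ℕ} (hk : m + 4 = 2 * k) {x : Fin (m + 4) → ℝ}
    (hx : x ∈ latticePts (m + 4)) (hxn : x ∈ (n : ℝ) • polyB4 (m + 4)) :
    ∃ ε N, ε ≤ 1 ∧ N + ε * k = n ∧ ∃ p ∈ params m ε N, latPt m ε p = x := by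
  rw [mem_smul_polyB4_iff (Nat.cast_nonneg n)] at hxn
  choose z hz using hx
  obtain rfl : x = fun i => (z i : ℝ) := funext hz
  obtain ⟨h1, h2, h3, h4, h5, h6⟩ := hxn
  rw [level_apply] at h5 h6
  norm_cast at h1 h2 h3 h4 h5 h6
  have h2' : ∀ j ∈ mid m, z (idxL m) ≤ 2 * z j := fun j hj => by exact_mod_cast h2 j hj
  obtain ⟨c, hc⟩ : ∃ c : ℕ, (c : ℤ) = z (idxL m) / 2 := ⟨_, Int.toNat_of_nonneg (by omega)⟩
  obtain ⟨ε, hε⟩ : ∃ ε : ℕ, (ε : ℤ) = z (idxL m) % 2 := ⟨_, Int.toNat_of_nonneg (by omega)⟩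
  have hL : z (idxL m) = 2 * c + ε := by omega
  have hε1 : ε ≤ 1 := by omega
  obtain ⟨q, hq⟩ : ∃ q : ℕ, (q : ℤ) = z (idxQ m) := ⟨_, Int.toNat_of_nonneg h3⟩
  obtain ⟨r, hr⟩ : ∃ r : ℕ, (r : ℤ) = z 0 + q - c - ε := ⟨_, Int.toNat_of_nonneg (by omega)⟩
  have hm : ∀ j ∈ mid m, ((z j - c - ε).toNat : ℤ) = z j - c - ε := fun j hj =>
    Int.toNat_of_nonneg (by have := h2' j hj; omega)
  set M : ℕ := ∑ j ∈ mid m, (z j - c - ε).toNat with hM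
  have hsum : z (idxL m) + ∑ j ∈ mid m, (2 * z j - z (idxL m)) = 2 * c + 2 * M + ε * (m + 2) := by
    rw [Finset.sum_congr rfl (g := fun j => 2 * ((z j - c - ε).toNat : ℤ) + ε)
      fun j hj => by rw [hm j hj, hL]; ring, Finset.sum_add_distrib, ← Finset.mul_sum,
      Finset.sum_const, card_mid, nsmul_eq_mul, hL, hM]
    push_cast
    ring
  rw [hsum] at h5 h6
  have hεk : (ε : ℤ) * (m + 2) = 2 * (ε * k) - 2 * ε := by
    have : (m : ℤ) + 4 = 2 * k := by exact_mod_cast hk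
    rw [show (m : ℤ) + 2 = 2 * k - 2 by omega]
    ring
  rw [hεk] at h5 h6
  obtain ⟨σ, hσ⟩ : ∃ σ : ℕ, (σ : ℤ) = n - c - M - ε * k :=
    ⟨_, Int.toNat_of_nonneg (by omega)⟩
  let g : Fin (m + 4) → ℕ := fun j =>
    if j = idxL m then c else if j = idxQ m then σ else if j = 0 then 0 else (z j - c - ε).toNat
  have gL : g (idxL m) = c := by simp [g]
  have gQ : g (idxQ m) = σ := by simp [g, idxQ_ne_idxL]
  have g0 : g 0 = 0 := by simp [g, (idxL_ne_zero m).symm, (idxQ_ne_zero m).symm]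
  have gm : ∀ j ∈ mid m, g j = (z j - c - ε).toNat := fun j hj => by
    simp [g, ne_of_mem_mid hj]
  refine ⟨ε, c + σ + M, hε1, by zify; linarith, ⟨Finsupp.equivFunOnFinite.symm g, q, r⟩, ?_, ?_⟩
  · rw [mem_params]
    simp only [Finsupp.equivFunOnFinite_symm_apply_apply, gL, gQ, g0, Finset.sum_congr rfl gm, ← hM]
    refine ⟨⟨by ring, trivial⟩, ?_, ?_⟩ <;> omega
  · funext j
    rcases idx_cases j with rfl | rfl | rfl | hj
    · rw [latPt_zero]
      simp only [Finsupp.equivFunOnFinite_symm_apply_apply, gL]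
      have : (r : ℤ) - q + c + ε = z 0 := by omega
      exact_mod_cast this
    · rw [latPt_idxQ]
      exact_mod_cast hq
    · rw [latPt_idxL]
      simp only [Finsupp.equivFunOnFinite_symm_apply_apply, gL]
      exact_mod_cast hL.symm
    · rw [latPt_mid _ _ _ hj]
      simp only [Finsupp.equivFunOnFinite_symm_apply_apply, gL, gm j hj]
      have : ((z j - c - ε).toNat : ℤ) + c + ε = z j := by rw [hm j hj]; ring
      exact_mod_cast this

lemma latPt_ne_latPt {m : ℕ} (p p' : Σ _ : Fin (m + 4) →₀ ℕ, ℕ × ℕ) :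
    latPt m 0 p ≠ latPt m 1 p' := by
  intro h
  have := congrFun h (idxL m)
  rw [latPt_idxL, latPt_idxL] at this
  norm_cast at this
  omega

lemma ehrhartCount_polyB4 {m k : ℕ} (hk : m + 4 = 2 * k) (n : ℕ) :
    ehrhartCount (polyB4 (m + 4)) n =
      (params m 0 n).card + if k ≤ n then (params m 1 (n - k)).card else 0 := by
  classical
  rw [ehrhartCount]
  have h0 : (latPt m 0 '' (params m 0 n : Set _)).ncard = (params m 0 n).card := by
    rw [(latPt_injOn m 0 n).ncard_image, Set.ncard_coe_finset]
  split_ifs with hkn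
  · have heq : latticePts (m + 4) ∩ (n : ℝ) • polyB4 (m + 4) =
        latPt m 0 '' (params m 0 n) ∪ latPt m 1 '' (params m 1 (n - k)) := by
      ext x
      constructor
      · rintro ⟨hx, hxn⟩
        obtain ⟨ε, N, hε, hN, p, hp, rfl⟩ := exists_latPt_eq hk hx hxn
        obtain rfl | rfl : ε = 0 ∨ ε = 1 := by omega
        · obtain rfl : N = n := by omega
          exact Or.inl ⟨p, hp, rfl⟩
        · obtain rfl : N = n - k := by omega
          exact Or.inr ⟨p, hp, rfl⟩
      · rintro (⟨p, hp, rfl⟩ | ⟨p, hp, rfl⟩)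
        · exact ⟨latPt_mem_latticePts _ _ _, latPt_mem_smul hk (by omega) hp⟩
        · exact ⟨latPt_mem_latticePts _ _ _, latPt_mem_smul hk (by omega) hp⟩
    rw [heq, Set.ncard_union_eq _ ((Finset.finite_toSet _).image _)
      ((Finset.finite_toSet _).image _), h0,
      (latPt_injOn m 1 _).ncard_image, Set.ncard_coe_finset]
    rw [Set.disjoint_left]
    rintro _ ⟨p, -, rfl⟩ ⟨p', -, h⟩
    exact latPt_ne_latPt p p' h.symm
  · have heq : latticePts (m + 4) ∩ (n : ℝ) • polyB4 (m + 4) = latPt m 0 '' (params m 0 n) := by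
      ext x
      constructor
      · rintro ⟨hx, hxn⟩
        obtain ⟨ε, N, hε, hN, p, hp, rfl⟩ := exists_latPt_eq hk hx hxn
        obtain rfl | rfl : ε = 0 ∨ ε = 1 := by omega
        · obtain rfl : N = n := by omega
          exact ⟨p, hp, rfl⟩
        · omega
      · rintro ⟨p, hp, rfl⟩
        exact ⟨latPt_mem_latticePts _ _ _, latPt_mem_smul hk (by omega) hp⟩
    rw [heq, h0, add_zero]

lemma not_spansLattice_polyB4 {m k : ℕ} (hk : m + 4 = 2 * k) :
    ¬ SpansLattice (polyB4 (m + 4)) := by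
  intro h
  let S : AddSubgroup (Fin (m + 4 + 1) → ℤ) :=
    (AddSubgroup.zmultiples (2 : ℤ)).comap (Pi.evalAddMonoidHom (fun _ => ℤ) (idxL m).castSucc)
  have hS : ∀ y, y ∈ S ↔ (2 : ℤ) ∣ y (idxL m).castSucc := fun y => by
    simp [S, AddSubgroup.mem_comap, Int.mem_zmultiples_iff]
  have hle : (⊤ : AddSubgroup (Fin (m + 4 + 1) → ℤ)) ≤ S := by
    rw [← h, AddSubgroup.closure_le]
    rintro y ⟨-, hy⟩
    rw [SetLike.mem_coe, hS]
    obtain ⟨ε, N, hε, hN, p, hp, hpx⟩ := exists_latPt_eq (n := 1) hk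
      (fun i => ⟨y i.castSucc, rfl⟩) (by simpa using hy)
    obtain rfl | rfl : ε = 0 ∨ ε = 1 := by omega
    · have := congrFun hpx (idxL m)
      rw [latPt_idxL] at this
      exact ⟨p.1 (idxL m), by exact_mod_cast this.symm⟩
    · omega
  have := (hS (fun _ => 1)).1 (hle trivial)
  omega

lemma card_params (m ε N : ℕ) : ((params m ε N).card : ℤ) =
    PowerSeries.coeff N (((PowerSeries.mk 1 : PowerSeries ℤ) ^ (m + 2)) *
      PowerSeries.mk fun s : ℕ => ((s : ℤ) + 1 + ε) * (s + 1)) := by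
  let G : Fin (m + 4) → PowerSeries ℤ := fun j =>
    if j = idxQ m then PowerSeries.mk fun s : ℕ => ((s : ℤ) + 1 + ε) * (s + 1)
    else PowerSeries.mk 1
  have hG : ∀ j, j ≠ idxQ m → G j = PowerSeries.mk 1 := fun j hj => by simp [G, hj]
  have hQ : idxQ m ∈ tupleIdx m := by simp [tupleIdx]
  have hcard : ((tupleIdx m).erase (idxQ m)).card = m + 2 := by
    rw [Finset.card_erase_of_mem hQ, tupleIdx, Finset.card_insert_of_notMem,
      Finset.card_insert_of_notMem (idxQ_notMem_mid m), card_mid]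
    · omega
    · simp [(idxQ_ne_idxL m).symm, idxL_notMem_mid]
  have hprod : (PowerSeries.mk 1 : PowerSeries ℤ) ^ (m + 2) *
      PowerSeries.mk (fun s : ℕ => ((s : ℤ) + 1 + ε) * (s + 1)) = ∏ j ∈ tupleIdx m, G j := by
    rw [← Finset.prod_erase_mul _ _ hQ, Finset.prod_congr rfl fun j hj =>
      hG j (Finset.ne_of_mem_erase hj), Finset.prod_const, hcard]
    simp [G]
  rw [hprod, PowerSeries.coeff_prod, params, Finset.card_sigma]
  push_cast
  refine Finset.sum_congr rfl fun l _ => ?_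
  rw [← Finset.prod_erase_mul _ _ hQ, Finset.prod_eq_one fun j hj => by
    rw [hG j (Finset.ne_of_mem_erase hj)]; simp]
  simp [G]

lemma one_sub_X_pow_three_mul_mk (f : ℕ → ℤ) (a b c : ℤ) (h0 : f 0 = a) (h1 : f 1 = b + 3 * a)
    (h2 : f 2 = c + 3 * f 1 - 3 * f 0) (h : ∀ n, f (n + 3) = 3 * f (n + 2) - 3 * f (n + 1) + f n) :
    (1 - PowerSeries.X) ^ 3 * PowerSeries.mk f = PowerSeries.C a + PowerSeries.C b * PowerSeries.X +
      PowerSeries.C c * PowerSeries.X ^ 2 := by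
  have : (1 - PowerSeries.X) ^ 3 * PowerSeries.mk f = PowerSeries.mk f -
      PowerSeries.C 3 * (PowerSeries.X ^ 1 * PowerSeries.mk f) +
      PowerSeries.C 3 * (PowerSeries.X ^ 2 * PowerSeries.mk f) -
      PowerSeries.X ^ 3 * PowerSeries.mk f := by
    rw [show (PowerSeries.C (3 : ℤ)) = 3 from map_ofNat _ 3]
    ring
  rw [this]
  ext n
  simp only [map_add, map_sub, PowerSeries.coeff_C_mul, PowerSeries.coeff_X_pow_mul',
    PowerSeries.coeff_mk, PowerSeries.coeff_C, PowerSeries.coeff_X, PowerSeries.coeff_X_pow]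
  rcases n with _ | _ | _ | n
  · simp [h0]
  · simp [h0, h1]
  · simp [h2, h1, h0]
    ring
  · simp [h]
    ring_nf

lemma hasDeltaPoly_polyB4 {m k : ℕ} (hk : m + 4 = 2 * k) :
    HasDeltaPoly (polyB4 (m + 4)) (1 + X + Polynomial.C 2 * X ^ k) := by
  let F : ℕ → PowerSeries ℤ := fun ε => (PowerSeries.mk 1 : PowerSeries ℤ) ^ (m + 2) *
      PowerSeries.mk fun s : ℕ => ((s : ℤ) + 1 + ε) * (s + 1)
  have hF : ∀ ε, (1 - PowerSeries.X) ^ (m + 4 + 1) * F ε = (1 - PowerSeries.X) ^ 3 *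
      PowerSeries.mk fun s : ℕ => ((s : ℤ) + 1 + ε) * (s + 1) := fun ε => by
    have h1 := congrArg (· ^ (m + 2)) (PowerSeries.mk_one_mul_one_sub_eq_one ℤ)
    simp only [mul_pow, one_pow] at h1
    rw [show m + 4 + 1 = (m + 2) + 3 by ring, pow_add]
    simp only [F]
    linear_combination ((1 - PowerSeries.X) ^ 3 *
      PowerSeries.mk fun s : ℕ => ((s : ℤ) + 1 + ε) * (s + 1)) * h1
  have h0 := hF 0
  rw [one_sub_X_pow_three_mul_mk _ 1 1 0 (by norm_num) (by norm_num) (by norm_num)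
    (fun n => by push_cast; ring)] at h0
  have h1 := hF 1
  rw [one_sub_X_pow_three_mul_mk _ 2 0 0 (by norm_num) (by norm_num) (by norm_num)
    (fun n => by push_cast; ring)] at h1
  have hcount : ∀ n, (ehrhartCount (polyB4 (m + 4)) n : ℤ) =
      PowerSeries.coeff n (F 0 + PowerSeries.X ^ k * F 1) := fun n => by
    rw [ehrhartCount_polyB4 hk, map_add, PowerSeries.coeff_X_pow_mul']
    push_cast
    rw [card_params, card_params]
  have hser : ehrhartSeries (polyB4 (m + 4)) = F 0 + PowerSeries.X ^ k * F 1 := by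
    ext n
    rw [ehrhartSeries, PowerSeries.coeff_mk]
    split_ifs with hn
    · subst hn
      have hk0 : k ≠ 0 := by omega
      simp [F, hk0]
    · exact hcount n
  rw [HasDeltaPoly, hser, mul_add, h0, mul_left_comm, h1]
  simp only [map_one, map_zero, zero_mul, add_zero, one_mul, Polynomial.coe_add, Polynomial.coe_one,
    Polynomial.coe_X, Polynomial.coe_mul, Polynomial.coe_pow, Polynomial.coe_C]
  ring

end PolyB4

/-- properties of `B⁽⁴⁾` for `d = 2k`, `k ≥ 2`. -/
theorem polyB4_properties (k : ℕ) (hk : 2 ≤ k) (d : ℕ) (hd : d = 2 * k) :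
    IsLatticePolytope (polyB4 d) ∧
    affineSpan ℝ (polyB4 d) = ⊤ ∧
    ((polyB4 d).extremePoints ℝ).ncard = d + 2 ∧
    ¬ IsSimplex (polyB4 d) ∧
    ¬ IsLatticePyramid (polyB4 d) ∧
    HasDeltaPoly (polyB4 d) (1 + X + Polynomial.C 2 * X ^ k) ∧
    ((1 + X + Polynomial.C 2 * X ^ k : Polynomial ℤ).eval 1 = 4) ∧
    ¬ SpansLattice (polyB4 d) := by
  obtain ⟨m, rfl⟩ : ∃ m, d = m + 4 := ⟨d - 4, by omega⟩
  refine ⟨PolyB4.isLatticePolytope_polyB4 m, PolyB4.affineSpan_polyB4 m, ?_,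
    PolyB4.not_isSimplex_polyB4 m, PolyB4.not_isLatticePyramid_polyB4 m,
    PolyB4.hasDeltaPoly_polyB4 hd, ?_, PolyB4.not_spansLattice_polyB4 hd⟩
  · rw [PolyB4.extremePoints_polyB4, PolyB4.ncard_verts]
  · simp
end
end

section
/- Let P ⊂ ℝ^d be a lattice polytope of dimension d which is not a simplex, with Vol(P) = 4 and ℤ((P,1) ∩ ℤ^{d+1}) ≠ ℤ^{d+1}. Then: (i) P contains no d-dimensional lattice simplex of normalized volume 1 whose vertices are lattice points of P (indeed, if a lattice polytope contains a unimodular d-simplex among its lattice points, then ℤ((P,1) ∩ ℤ^{d+1}) = ℤ^{d+1}); and (ii) every lattice triangulation of P contains exactly two d-dimensional lattice simplices, each of normalized volume 2. -/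
open Pointwise Polynomial

noncomputable section

/-- A (possibly empty, possibly lower-dimensional) lattice simplex in `ℝ^d`. -/
def IsLatticeSimplexOrEmpty {d : ℕ} (S : Set (Fin d → ℝ)) : Prop :=
  S = ∅ ∨ ∃ (n : ℕ) (v : Fin (n + 1) → Fin d → ℝ), AffineIndependent ℝ v ∧
    (∀ i, v i ∈ latticePts d) ∧ S = convexHull ℝ (Set.range v)

/-- A lattice triangulation of `P`: a finite collection of lattice simplices, closed
under taking faces, any two members meeting in a common (possibly empty) face, whose
union is `P`. -/
def IsLatticeTriangulation {d : ℕ} (T : Finset (Set (Fin d → ℝ)))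
    (P : Set (Fin d → ℝ)) : Prop :=
  (∀ S ∈ T, IsLatticeSimplexOrEmpty S) ∧
  (∀ S ∈ T, ∀ F : Set (Fin d → ℝ), IsExposed ℝ S F → F ∈ T) ∧
  (∀ S₁ ∈ T, ∀ S₂ ∈ T, IsExposed ℝ S₁ (S₁ ∩ S₂) ∧ IsExposed ℝ S₂ (S₁ ∩ S₂)) ∧
  ⋃₀ (T : Set (Set (Fin d → ℝ))) = P

/-- Affinely independent points admit at most one combination with prescribed total weight. -/
theorem AffineIndependent.weights_ext {d n : ℕ} {v : Fin n → Fin d → ℝ}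
    (hv : AffineIndependent ℝ v) {c c' : Fin n → ℝ} (hs : ∑ i, c i = ∑ i, c' i)
    (hl : ∀ j, ∑ i, c i * v i j = ∑ i, c' i * v i j) : c = c' := by
  funext i
  have := affineIndependent_iff.1 hv Finset.univ (fun i => c i - c' i) (by simp [hs]) (by
    ext j
    simp [Finset.sum_apply, sub_mul, hl]) i (Finset.mem_univ i)
  linarith

/-- The vertices of a full-dimensional simplex, lifted to height one, span `ℝ^d × ℝ`. -/
theorem AffineIndependent.exists_weights {d : ℕ} {v : Fin (d + 1) → Fin d → ℝ}
    (hv : AffineIndependent ℝ v) (x : Fin d → ℝ) (t : ℝ) :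
    ∃ c : Fin (d + 1) → ℝ, ∑ i, c i = t ∧ ∀ j, ∑ i, c i * v i j = x j := by
  let L : (Fin (d + 1) → ℝ) →ₗ[ℝ] (Fin d → ℝ) × ℝ :=
    { toFun := fun c => (fun j => ∑ i, c i * v i j, ∑ i, c i)
      map_add' := fun c c' => by
        ext <;> simp [add_mul, Finset.sum_add_distrib]
      map_smul' := fun r c => by
        ext <;> simp [Finset.mul_sum, mul_assoc] }
  have hinj : Function.Injective L := fun c c' h =>
    hv.weights_ext (congrArg Prod.snd h) (fun j => congrFun (congrArg Prod.fst h) j)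
  have hsurj : Function.Surjective L :=
    (LinearMap.injective_iff_surjective_of_finrank_eq_finrank (by simp)).1 hinj
  obtain ⟨c, hc⟩ := hsurj (x, t)
  exact ⟨c, congrArg Prod.snd hc, fun j => congrFun (congrArg Prod.fst hc) j⟩

theorem simplexLambda_finite {d : ℕ} {v : Fin (d + 1) → Fin d → ℝ}
    (hv : AffineIndependent ℝ v) : (simplexLambda v).Finite := by
  let M : Fin d → ℝ := fun j => ∑ i, |v i j|
  let f : (Fin (d + 1) → ℝ) → (Fin d → ℤ) × ℤ :=
    fun c => (fun j => ⌊∑ i, c i * v i j⌋, ⌊∑ i, c i⌋)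
  have hfl : ∀ c ∈ simplexLambda v, (∀ j, ((f c).1 j : ℝ) = ∑ i, c i * v i j) ∧
      ((f c).2 : ℝ) = ∑ i, c i := by
    rintro c ⟨-, h2, z, hz⟩
    refine ⟨fun j => ?_, by simp [f, hz]⟩
    obtain ⟨w, hw⟩ := h2 j
    simp [f, hw]
  refine Set.Finite.of_finite_image (f := f)
    (((Set.finite_Icc (fun j => -⌈M j⌉) (fun j => ⌈M j⌉)).prod
      (Set.finite_Icc 0 ((d : ℤ) + 1))).subset ?_) ?_
  · rintro _ ⟨c, hc, rfl⟩
    obtain ⟨h1, h2⟩ := hfl c hc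
    have hb : ∀ j, |((f c).1 j : ℝ)| ≤ ⌈M j⌉ := fun j => by
      rw [h1 j]
      refine le_trans (Finset.abs_sum_le_sum_abs _ _) (le_trans ?_ (Int.le_ceil _))
      refine Finset.sum_le_sum fun i _ => ?_
      rw [abs_mul, abs_of_nonneg (hc.1 i).1]
      exact mul_le_of_le_one_left (abs_nonneg _) (hc.1 i).2.le
    refine ⟨⟨fun j => ?_, fun j => ?_⟩, ?_, ?_⟩
    · have := (abs_le.1 (hb j)).1
      exact_mod_cast this
    · have := (abs_le.1 (hb j)).2
      exact_mod_cast this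
    · have : (0 : ℝ) ≤ (f c).2 := h2 ▸ Finset.sum_nonneg fun i _ => (hc.1 i).1
      exact_mod_cast this
    · have : ((f c).2 : ℝ) ≤ (d : ℝ) + 1 := by
        rw [h2]
        refine (Finset.sum_le_sum fun i _ => (hc.1 i).2.le).trans ?_
        simp
      exact_mod_cast this
  · intro c hc c' hc' h
    refine hv.weights_ext ?_ fun j => ?_
    · rw [← (hfl c hc).2, ← (hfl c' hc').2, h]
    · rw [← (hfl c hc).1, ← (hfl c' hc').1, h]

theorem zero_mem_simplexLambda {d : ℕ} (v : Fin (d + 1) → Fin d → ℝ) :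
    (0 : Fin (d + 1) → ℝ) ∈ simplexLambda v :=
  ⟨fun _ => ⟨le_rfl, one_pos⟩, fun _ => ⟨0, by simp⟩, ⟨0, by simp⟩⟩

theorem mem_convexHull_range_iff_weights {d n : ℕ} (v : Fin n → Fin d → ℝ) (x : Fin d → ℝ) :
    x ∈ convexHull ℝ (Set.range v) ↔
      ∃ c : Fin n → ℝ, (∀ i, 0 ≤ c i) ∧ ∑ i, c i = 1 ∧ ∀ j, ∑ i, c i * v i j = x j := by
  have h := LinearMap.image_convexHull (Fintype.linearCombination ℝ v)
    (Set.range fun i : Fin n => (Pi.single i (1 : ℝ) : Fin n → ℝ))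
  rw [convexHull_rangle_single_eq_stdSimplex, ← Set.range_comp] at h
  have h' : ((Fintype.linearCombination ℝ v) ∘ fun i : Fin n => (Pi.single i (1 : ℝ))) = v := by
    ext i j
    simp [Fintype.linearCombination_apply_single]
  rw [h'] at h
  rw [← h]
  constructor
  · rintro ⟨c, ⟨h0, h1⟩, rfl⟩
    exact ⟨c, h0, h1, fun j => by simp [Fintype.linearCombination_apply, Finset.sum_apply]⟩
  · rintro ⟨c, h0, h1, h2⟩
    refine ⟨c, ⟨h0, h1⟩, ?_⟩
    ext j
    simp [Fintype.linearCombination_apply, Finset.sum_apply, h2]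

theorem mem_smul_convexHull_range_iff_weights {d n : ℕ} [NeZero n] (v : Fin n → Fin d → ℝ)
    (m : ℕ) (x : Fin d → ℝ) :
    x ∈ (m : ℝ) • convexHull ℝ (Set.range v) ↔
      ∃ c : Fin n → ℝ, (∀ i, 0 ≤ c i) ∧ ∑ i, c i = m ∧ ∀ j, ∑ i, c i * v i j = x j := by
  constructor
  · rintro ⟨y, hy, rfl⟩
    obtain ⟨c, h0, h1, h2⟩ := (mem_convexHull_range_iff_weights v y).1 hy
    refine ⟨fun i => m * c i, fun i => by have := h0 i; positivity, ?_, fun j => ?_⟩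
    · rw [← Finset.mul_sum, h1, mul_one]
    · simp [mul_assoc, ← Finset.mul_sum, h2]
  · rintro ⟨c, h0, h1, h2⟩
    rcases Nat.eq_zero_or_pos m with rfl | hm
    · have hc : ∀ i, c i = 0 := fun i =>
        (Finset.sum_eq_zero_iff_of_nonneg fun i _ => h0 i).1 (by simpa using h1) i
          (Finset.mem_univ i)
      refine ⟨v 0, subset_convexHull ℝ _ ⟨0, rfl⟩, ?_⟩
      ext j
      simp [← h2, hc]
    · have hm' : (m : ℝ) ≠ 0 := by positivity
      refine ⟨(m : ℝ)⁻¹ • x, ?_, by simp [smul_smul, hm']⟩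
      refine (mem_convexHull_range_iff_weights v _).2
        ⟨fun i => (m : ℝ)⁻¹ * c i, fun i => by have := h0 i; positivity, ?_, fun j => ?_⟩
      · rw [← Finset.mul_sum, h1, inv_mul_cancel₀ hm']
      · simp [mul_assoc, ← Finset.mul_sum, h2]

/-- The Ehrhart series is `p / (1 - t)^(d+1)`, with the denominator expanded. -/
theorem hasDeltaPoly_iff {d : ℕ} (P : Set (Fin d → ℝ)) (p : Polynomial ℤ) :
    HasDeltaPoly P p ↔
      ehrhartSeries P = p * (PowerSeries.mk fun n => (Nat.choose (d + n) d : ℤ)) := by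
  have h := PowerSeries.mk_add_choose_mul_one_sub_pow_eq_one ℤ d
  unfold HasDeltaPoly
  constructor
  · intro hp
    rw [← hp]
    linear_combination (- ehrhartSeries P) * h
  · intro hp
    rw [hp]
    linear_combination (p : PowerSeries ℤ) * h

/-- The `δ`-polynomial is unique. -/
theorem HasDeltaPoly.unique {d : ℕ} {P : Set (Fin d → ℝ)} {p q : Polynomial ℤ}
    (hp : HasDeltaPoly P p) (hq : HasDeltaPoly P q) : p = q :=
  Polynomial.coe_injective ℤ (hp.symm.trans hq)

/-- The lattice points of the `m`-th dilate of a lattice simplex: each one is uniquely a point of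
the half-open fundamental parallelepiped plus a nonnegative integer combination of vertices. -/
theorem ehrhartCount_simplex {d : ℕ} {v : Fin (d + 1) → Fin d → ℝ}
    (hv : AffineIndependent ℝ v) (hl : ∀ i, v i ∈ latticePts d) (m : ℕ) :
    ehrhartCount (convexHull ℝ (Set.range v)) m =
      ∑ b ∈ (simplexLambda_finite hv).toFinset,
        if ⌊∑ i, b i⌋₊ ≤ m then Nat.choose (d + (m - ⌊∑ i, b i⌋₊)) d else 0 := by
  classical
  set Λ := (simplexLambda_finite hv).toFinset with hΛ
  let h : (Fin (d + 1) → ℝ) → ℕ := fun b => ⌊∑ i, b i⌋₊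
  have hh : ∀ b ∈ simplexLambda v, (h b : ℝ) = ∑ i, b i := by
    rintro b ⟨h1, -, z, hz⟩
    have h0 : 0 ≤ ∑ i, b i := Finset.sum_nonneg fun i _ => (h1 i).1
    have hz0 : 0 ≤ z := by rw [hz] at h0; exact_mod_cast h0
    lift z to ℕ using hz0
    simp [h, hz]
  let I : Finset ((_ : Fin (d + 1) → ℝ) × (Fin (d + 1) → ℕ)) :=
    (Λ.filter fun b => h b ≤ m).sigma fun b => Finset.piAntidiag Finset.univ (m - h b)
  let f : ((_ : Fin (d + 1) → ℝ) × (Fin (d + 1) → ℕ)) → Fin d → ℝ :=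
    fun p j => ∑ i, (p.1 i + p.2 i) * v i j
  have hI : ∀ p ∈ I, p.1 ∈ simplexLambda v ∧ ∑ i, (p.1 i + p.2 i) = (m : ℝ) := by
    rintro ⟨b, k⟩ hp
    simp only [I, hΛ, Finset.mem_sigma, Finset.mem_filter, Set.Finite.mem_toFinset,
      Finset.mem_piAntidiag] at hp
    obtain ⟨⟨hb, hm⟩, hk, -⟩ := hp
    refine ⟨hb, ?_⟩
    rw [Finset.sum_add_distrib, ← hh b hb, ← Nat.cast_sum, hk, ← Nat.cast_add,
      Nat.add_sub_cancel' hm]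
  have hinj : Set.InjOn f I := by
    rintro ⟨b, k⟩ hp ⟨b', k'⟩ hp' hf
    obtain ⟨hb, hs⟩ := hI _ hp
    obtain ⟨hb', hs'⟩ := hI _ hp'
    have hc := hv.weights_ext (hs.trans hs'.symm) (fun j => congrFun hf j)
    have hk : k = k' := by
      funext i
      have := congrFun hc i
      have e := congrArg Nat.floor this
      simpa [Nat.floor_add_natCast (hb.1 i).1, Nat.floor_add_natCast (hb'.1 i).1,
        Nat.floor_eq_zero.2 (hb.1 i).2, Nat.floor_eq_zero.2 (hb'.1 i).2] using e
    subst hk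
    have : b = b' := by
      funext i
      have := congrFun hc i
      simpa using this
    subst this
    rfl
  choose w hw using hl
  have himg : latticePts d ∩ (m : ℝ) • convexHull ℝ (Set.range v) = ↑(I.image f) := by
    ext x
    rw [Finset.coe_image, Set.mem_inter_iff, mem_smul_convexHull_range_iff_weights]
    constructor
    · rintro ⟨hx, c, h0, h1, h2⟩
      have hb : (fun i => Int.fract (c i)) ∈ simplexLambda v := by
        refine ⟨fun i => ⟨Int.fract_nonneg _, Int.fract_lt_one _⟩, fun j => ?_, ?_⟩
        · obtain ⟨z, hz⟩ := hx j
          refine ⟨z - ∑ i, ⌊c i⌋ * w i j, ?_⟩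
          push_cast
          rw [← hz, ← h2 j, ← Finset.sum_sub_distrib]
          exact Finset.sum_congr rfl fun i _ => by rw [← hw i j, Int.fract]; ring
        · refine ⟨m - ∑ i, ⌊c i⌋, ?_⟩
          push_cast
          rw [← h1, ← Finset.sum_sub_distrib]
          rfl
      have hc : ∀ i, Int.fract (c i) + (⌊c i⌋₊ : ℝ) = c i := fun i => by
        rw [natCast_floor_eq_intCast_floor (h0 i), Int.fract_add_floor]
      have hsum : (h fun i => Int.fract (c i)) + ∑ i, ⌊c i⌋₊ = m := by
        have : ((h fun i => Int.fract (c i) : ℕ) : ℝ) + ∑ i, (⌊c i⌋₊ : ℝ) = m := by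
          rw [hh _ hb, ← Finset.sum_add_distrib, ← h1]
          exact Finset.sum_congr rfl fun i _ => hc i
        exact_mod_cast this
      refine ⟨⟨fun i => Int.fract (c i), fun i => ⌊c i⌋₊⟩, ?_, ?_⟩
      · simp only [I, hΛ, Finset.coe_sigma, Set.mem_sigma_iff, Finset.mem_coe, Finset.mem_filter,
          Set.Finite.mem_toFinset, Finset.mem_piAntidiag]
        exact ⟨⟨hb, by omega⟩, by omega, by simp⟩
      · funext j
        simp only [f, hc, h2]
    · rintro ⟨p, hp, rfl⟩
      obtain ⟨hb, hs⟩ := hI p hp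
      refine ⟨fun j => ?_, fun i => p.1 i + p.2 i, fun i => ?_, hs, fun j => rfl⟩
      · obtain ⟨z, hz⟩ := hb.2.1 j
        refine ⟨z + ∑ i, p.2 i * w i j, ?_⟩
        push_cast
        simp only [f, add_mul, Finset.sum_add_distrib, hz, ← hw]
      · have := (hb.1 i).1
        positivity
  have hcard : ∀ n, (Finset.piAntidiag (Finset.univ : Finset (Fin (d + 1))) n).card =
      Nat.choose (d + n) d := fun n => by
    have h := Finset.card_finsuppAntidiag_nat_eq_choose (s := (Finset.univ : Finset (Fin (d + 1)))) n
    rw [Finset.finsuppAntidiag, Finset.card_map, Finset.card_attach] at h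
    rw [h, Finset.card_univ, Fintype.card_fin, Nat.add_right_comm, Nat.add_sub_cancel,
      Nat.choose_symm_add]
  rw [ehrhartCount, himg, Set.ncard_coe_finset, Finset.card_image_of_injOn hinj,
    Finset.card_sigma, Finset.sum_filter]
  simp only [hcard, h]

/-- The `δ`-polynomial of a lattice simplex counts the points of the half-open fundamental
parallelepiped by height. -/
theorem exists_hasDeltaPoly_simplex {d : ℕ} {v : Fin (d + 1) → Fin d → ℝ}
    (hv : AffineIndependent ℝ v) (hl : ∀ i, v i ∈ latticePts d) :
    ∃ q : Polynomial ℤ, HasDeltaPoly (convexHull ℝ (Set.range v)) q ∧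
      q.eval 1 = (simplexLambda v).ncard := by
  classical
  refine ⟨∑ b ∈ (simplexLambda_finite hv).toFinset, X ^ ⌊∑ i, b i⌋₊, ?_, ?_⟩
  · rw [hasDeltaPoly_iff]
    have h0 : ehrhartCount (convexHull ℝ (Set.range v)) 0 = 1 := by
      have hne : (convexHull ℝ (Set.range v)).Nonempty := ⟨v 0, subset_convexHull ℝ _ ⟨0, rfl⟩⟩
      have : latticePts d ∩ {0} = {0} :=
        Set.inter_eq_right.2 (by rintro _ rfl; exact fun i => ⟨0, by simp⟩)
      simp [ehrhartCount, Set.zero_smul_set hne, ← Set.singleton_zero, this]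
    ext n
    have h1 : (PowerSeries.coeff n) (ehrhartSeries (convexHull ℝ (Set.range v))) =
        (ehrhartCount (convexHull ℝ (Set.range v)) n : ℤ) := by
      rw [ehrhartSeries, PowerSeries.coeff_mk]
      split_ifs with hn
      · rw [hn, h0]; rfl
      · rfl
    rw [h1, ehrhartCount_simplex hv hl, ← Polynomial.coeToPowerSeries.ringHom_apply, map_sum,
      Finset.sum_mul, map_sum]
    push_cast
    refine Finset.sum_congr rfl fun b _ => ?_
    rw [map_pow, Polynomial.coeToPowerSeries.ringHom_apply, Polynomial.coe_X,
      PowerSeries.coeff_X_pow_mul']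
    simp
  · rw [Polynomial.eval_finsetSum, Set.ncard_eq_toFinset_card _ (simplexLambda_finite hv)]
    simp

section

open Filter Topology MeasureTheory

theorem tendsto_choose_sub_div_pow (d k : ℕ) :
    Tendsto (fun n : ℕ => (Nat.choose (d + (n - k)) d : ℝ) / (n : ℝ) ^ d) atTop
      (𝓝 (1 / d.factorial)) := by
  have hsub : Tendsto (fun n : ℕ => d + (n - k)) atTop atTop :=
    tendsto_atTop_mono (fun _ => Nat.le_add_left _ _) (tendsto_sub_atTop_nat k)
  have h1 : Tendsto (fun n : ℕ => (Nat.choose n d : ℝ) / (n : ℝ) ^ d) atTop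
      (𝓝 (1 / d.factorial)) := by
    have h0 : Tendsto (fun n : ℕ => (n : ℝ) * (n : ℝ)⁻¹) atTop (𝓝 1) := by
      refine tendsto_const_nhds.congr' ?_
      filter_upwards [eventually_gt_atTop 0] with n hn
      have : (n : ℝ) ≠ 0 := by positivity
      field_simp
    simpa [div_eq_mul_inv] using ProbabilityTheory.tendsto_choose_mul_pow_atTop d h0
  have h2 : Tendsto (fun n : ℕ => ((d + (n - k) : ℕ) : ℝ) / n) atTop (𝓝 1) := by
    have h3 : Tendsto (fun n : ℕ => 1 + ((d : ℝ) - k) / n) atTop (𝓝 (1 + 0)) :=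
      tendsto_const_nhds.add (tendsto_const_div_atTop_nhds_zero_nat _)
    rw [add_zero] at h3
    refine h3.congr' ?_
    filter_upwards [eventually_ge_atTop k, eventually_gt_atTop 0] with n hn hn0
    have : (n : ℝ) ≠ 0 := by positivity
    push_cast [Nat.cast_sub hn]
    field_simp
    ring
  have h3 := (h1.comp hsub).mul (h2.pow d)
  rw [one_pow, mul_one] at h3
  refine h3.congr' ?_
  filter_upwards [eventually_gt_atTop k] with n hn
  have : ((d + (n - k) : ℕ) : ℝ) ≠ 0 := by
    have : 0 < d + (n - k) := by omega
    positivity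
  have : (n : ℝ) ≠ 0 := by
    have : 0 < n := by omega
    positivity
  simp only [Function.comp, div_pow]
  field_simp

theorem HasDeltaPoly.tendsto_ehrhartCount {d : ℕ} {P : Set (Fin d → ℝ)} {p : Polynomial ℤ}
    (hp : HasDeltaPoly P p) :
    Tendsto (fun n : ℕ => (ehrhartCount P n : ℝ) / (n : ℝ) ^ d) atTop
      (𝓝 ((p.eval 1 : ℤ) / d.factorial)) := by
  have hcoe := (hasDeltaPoly_iff P p).1 hp
  have hlim : Tendsto (fun n : ℕ => ∑ k ∈ p.support,
      (p.coeff k : ℝ) * ((Nat.choose (d + (n - k)) d : ℝ) / (n : ℝ) ^ d)) atTop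
      (𝓝 (∑ k ∈ p.support, (p.coeff k : ℝ) * (1 / d.factorial))) :=
    tendsto_finsetSum _ fun k _ => (tendsto_choose_sub_div_pow d k).const_mul _
  have hval : ∑ k ∈ p.support, (p.coeff k : ℝ) * (1 / d.factorial) =
      (p.eval 1 : ℤ) / d.factorial := by
    rw [← Finset.sum_mul, Polynomial.eval_eq_sum, Polynomial.sum]
    push_cast
    simp [div_eq_mul_inv]
  rw [hval] at hlim
  refine hlim.congr' ?_
  filter_upwards [eventually_ge_atTop (p.natDegree), eventually_gt_atTop 0] with n hn hn0
  have h1 : (ehrhartCount P n : ℤ) = ∑ k ∈ p.support,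
      p.coeff k * (Nat.choose (d + (n - k)) d : ℤ) := by
    have h2 := congrArg (PowerSeries.coeff n) hcoe
    rw [ehrhartSeries, PowerSeries.coeff_mk, if_neg hn0.ne'] at h2
    rw [h2]
    conv_lhs => rw [p.as_sum_support, ← Polynomial.coeToPowerSeries.ringHom_apply, map_sum,
      Finset.sum_mul, map_sum]
    refine Finset.sum_congr rfl fun k hk => ?_
    have hkn : k ≤ n := (Polynomial.le_natDegree_of_mem_supp k hk).trans hn
    rw [← Polynomial.C_mul_X_pow_eq_monomial, Polynomial.coeToPowerSeries.ringHom_apply,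
      Polynomial.coe_mul, Polynomial.coe_C, Polynomial.coe_pow, Polynomial.coe_X, mul_assoc,
      PowerSeries.coeff_C_mul, PowerSeries.coeff_X_pow_mul', if_pos hkn, PowerSeries.coeff_mk]
  have h2 : (ehrhartCount P n : ℝ) = ∑ k ∈ p.support,
      (p.coeff k : ℝ) * (Nat.choose (d + (n - k)) d : ℝ) := by exact_mod_cast h1
  rw [h2, Finset.sum_div]
  exact Finset.sum_congr rfl fun k _ => by rw [mul_div_assoc]

theorem latticePts_eq_span (d : ℕ) :
    latticePts d = (Submodule.span ℤ (Set.range (Pi.basisFun ℝ (Fin d))) : Set (Fin d → ℝ)) := by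
  ext x
  rw [SetLike.mem_coe, Module.Basis.mem_span_iff_repr_mem]
  simp only [latticePts, Set.mem_ofPred_eq, Pi.basisFun_repr, Set.mem_range, eq_comm]
  rfl

/-- The value at `1` of the `δ`-polynomial is the normalized volume. -/
theorem HasDeltaPoly.eval_one_eq_volume {d : ℕ} {P : Set (Fin d → ℝ)} {p : Polynomial ℤ}
    (hp : HasDeltaPoly P p) (hconv : Convex ℝ P) (hcomp : IsCompact P) :
    (p.eval 1 : ℤ) = (d.factorial : ℝ) * volume.real P := by
  have h1 := tendsto_card_div_pow_atTop_volume P hcomp.isBounded hcomp.measurableSet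
    (hconv.addHaar_frontier volume)
  have h2 : ∀ᶠ n : ℕ in atTop, (Nat.card ↑(P ∩ (n : ℝ)⁻¹ •
      (Submodule.span ℤ (Set.range (Pi.basisFun ℝ (Fin d))) : Set (Fin d → ℝ))) : ℝ) /
      (n : ℝ) ^ Fintype.card (Fin d) = (ehrhartCount P n : ℝ) / (n : ℝ) ^ d := by
    filter_upwards [eventually_gt_atTop 0] with n hn
    have hn' : (n : ℝ) ≠ 0 := by positivity
    rw [Fintype.card_fin, ← latticePts_eq_span, ehrhartCount, Nat.card_coe_set_eq]
    congr 2
    have : latticePts d ∩ (n : ℝ) • P = (n : ℝ) • (P ∩ (n : ℝ)⁻¹ • latticePts d) := by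
      rw [Set.smul_set_inter₀ hn', smul_inv_smul₀ hn', Set.inter_comm]
    rw [this]
    exact (Set.ncard_image_of_injective _ (smul_right_injective _ hn')).symm
  have h3 := tendsto_nhds_unique (h1.congr' h2) hp.tendsto_ehrhartCount
  rw [h3]
  field_simp

theorem spansLattice_of_simplexLambda_ncard_eq_one {d : ℕ} {Q : Set (Fin d → ℝ)}
    {v : Fin (d + 1) → Fin d → ℝ} (hv : AffineIndependent ℝ v)
    (hl : ∀ i, v i ∈ latticePts d) (hQ : ∀ i, v i ∈ Q) (h1 : (simplexLambda v).ncard = 1) :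
    SpansLattice Q := by
  obtain ⟨a, ha⟩ := Set.ncard_eq_one.1 h1
  have hΛ : simplexLambda v = {0} := by
    have h0 := zero_mem_simplexLambda v
    rw [ha] at h0 ⊢
    rw [Set.mem_singleton_iff.1 h0]
  choose w hw using hl
  rw [SpansLattice, eq_top_iff]
  rintro y -
  obtain ⟨c, hs, hc⟩ := hv.exists_weights (fun j => (y j.castSucc : ℝ)) (y (Fin.last d))
  have hfr : (fun i => Int.fract (c i)) ∈ simplexLambda v := by
    refine ⟨fun i => ⟨Int.fract_nonneg _, Int.fract_lt_one _⟩, fun j => ?_, ?_⟩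
    · refine ⟨y j.castSucc - ∑ i, ⌊c i⌋ * w i j, ?_⟩
      push_cast
      rw [← hc j, ← Finset.sum_sub_distrib]
      exact Finset.sum_congr rfl fun i _ => by rw [← hw i j, Int.fract]; ring
    · refine ⟨y (Fin.last d) - ∑ i, ⌊c i⌋, ?_⟩
      push_cast
      rw [← hs, ← Finset.sum_sub_distrib]
      rfl
  rw [hΛ] at hfr
  have hfl : ∀ i, (⌊c i⌋ : ℝ) = c i := fun i => by
    have h0 : Int.fract (c i) = 0 := congrFun hfr i
    have := Int.fract_add_floor (c i)
    rwa [h0, zero_add] at this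
  have hy : y = ∑ i, ⌊c i⌋ • (Fin.snoc (w i) 1 : Fin (d + 1) → ℤ) := by
    funext j
    rw [Finset.sum_apply]
    refine Fin.lastCases ?_ (fun j => ?_) j
    · have : (y (Fin.last d) : ℝ) = ((∑ i, ⌊c i⌋ : ℤ) : ℝ) := by
        push_cast
        simp [hfl, hs]
      simpa using Int.cast_injective this
    · have : (y j.castSucc : ℝ) = ((∑ i, ⌊c i⌋ * w i j : ℤ) : ℝ) := by
        push_cast
        simp [hfl, ← hw, hc]
      simpa using Int.cast_injective this
  rw [hy]
  refine sum_mem fun i _ => zsmul_mem (AddSubgroup.subset_closure ?_) _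
  refine ⟨by simp, ?_⟩
  have : (fun j : Fin d => ((Fin.snoc (w i) 1 : Fin (d + 1) → ℤ) j.castSucc : ℝ)) = v i := by
    funext j
    simp [hw]
  rw [this]
  exact hQ i

/-- A lattice polytope containing a simplex whose `δ`-polynomial has value `1` at `1` spans. -/
theorem spansLattice_of_unimodular {d : ℕ} {Q : Set (Fin d → ℝ)}
    (h : ∃ v : Fin (d + 1) → Fin d → ℝ, AffineIndependent ℝ v ∧
      (∀ i, v i ∈ latticePts d ∧ v i ∈ Q) ∧
      (∃ q : Polynomial ℤ, HasDeltaPoly (convexHull ℝ (Set.range v)) q ∧ q.eval 1 = 1)) :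
    SpansLattice Q := by
  obtain ⟨v, hv, hvQ, q, hq, hq1⟩ := h
  obtain ⟨q', hq', hq1'⟩ := exists_hasDeltaPoly_simplex hv fun i => (hvQ i).1
  rw [hq'.unique hq, hq1] at hq1'
  exact spansLattice_of_simplexLambda_ncard_eq_one hv (fun i => (hvQ i).1) (fun i => (hvQ i).2)
    (by exact_mod_cast hq1'.symm)

theorem IsLatticePolytope.convex {d : ℕ} {P : Set (Fin d → ℝ)} (hP : IsLatticePolytope P) :
    Convex ℝ P := by
  obtain ⟨V, -, rfl⟩ := hP
  exact convex_convexHull ℝ _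

theorem IsLatticePolytope.isCompact {d : ℕ} {P : Set (Fin d → ℝ)} (hP : IsLatticePolytope P) :
    IsCompact P := by
  obtain ⟨V, -, rfl⟩ := hP
  exact V.finite_toSet.isCompact_convexHull ℝ

theorem IsLatticeSimplexOrEmpty.isLatticePolytope {d : ℕ} {S : Set (Fin d → ℝ)}
    (hS : IsLatticeSimplexOrEmpty S) : IsLatticePolytope S := by
  classical
  rcases hS with rfl | ⟨n, v, -, hl, rfl⟩
  · exact ⟨∅, by simp, by simp⟩
  · exact ⟨Finset.univ.image v, by simpa [Set.range_subset_iff] using hl, by simp⟩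

theorem IsLatticeSimplexOrEmpty.exists_vertices {d : ℕ} {S : Set (Fin d → ℝ)}
    (hS : IsLatticeSimplexOrEmpty S) (hspan : affineSpan ℝ S = ⊤) :
    ∃ v : Fin (d + 1) → Fin d → ℝ, AffineIndependent ℝ v ∧ (∀ i, v i ∈ latticePts d) ∧
      S = convexHull ℝ (Set.range v) := by
  rcases hS with rfl | ⟨n, v, hv, hl, rfl⟩
  · simp at hspan
  · rw [affineSpan_convexHull, hv.affineSpan_eq_top_iff_card_eq_finrank_add_one] at hspan
    obtain rfl : n = d := by simpa using hspan
    exact ⟨v, hv, hl, rfl⟩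

theorem volume_eq_zero_of_affineSpan_ne_top {d : ℕ} {S : Set (Fin d → ℝ)}
    (hS : affineSpan ℝ S ≠ ⊤) : volume S = 0 :=
  measure_mono_null (subset_affineSpan ℝ S) (Measure.addHaar_affineSubspace volume _ hS)

/-- A proper exposed face is a null set. -/
theorem IsExposed.volume_eq_zero {d : ℕ} {A B : Set (Fin d → ℝ)} (h : IsExposed ℝ A B)
    (hne : B ≠ A) : volume B = 0 := by
  rcases B.eq_empty_or_nonempty with rfl | hB
  · simp
  obtain ⟨l, hl⟩ := h hB
  obtain ⟨b, hb⟩ := hB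
  have hl0 : l ≠ 0 := by
    rintro rfl
    exact hne (by simpa using hl)
  refine volume_eq_zero_of_affineSpan_ne_top fun htop => hl0 ?_
  have hle : affineSpan ℝ B ≤
      (affineSpan ℝ {l b}).comap (l : (Fin d → ℝ) →ₗ[ℝ] ℝ).toAffineMap := by
    rw [affineSpan_le]
    intro x hx
    rw [hl] at hx hb
    have : l x = l b := le_antisymm (hb.2 x hx.1) (hx.2 b hb.1)
    simp [this]
  rw [htop, top_le_iff] at hle
  have hconst : ∀ x, l x = l b := fun x => by
    have : x ∈ (⊤ : AffineSubspace ℝ (Fin d → ℝ)) := trivial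
    rw [← hle] at this
    simpa using this
  ext x
  rw [hconst x, ← hconst 0]
  simp

theorem IsLatticeTriangulation.volume_eq_sum {d : ℕ} {T : Finset (Set (Fin d → ℝ))}
    {P : Set (Fin d → ℝ)} (hT : IsLatticeTriangulation T P) (F : Finset (Set (Fin d → ℝ)))
    (hF : ∀ S, S ∈ F ↔ S ∈ T ∧ affineSpan ℝ S = ⊤) :
    volume P = ∑ S ∈ F, volume S := by
  obtain ⟨h1, -, h3, rfl⟩ := hT
  rw [← measure_biUnion_finset₀ (f := fun S => S)]
  · refine le_antisymm ?_ (measure_mono ?_)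
    · have hsub : ⋃₀ (T : Set (Set (Fin d → ℝ))) ⊆
          (⋃ S ∈ F, S) ∪ ⋃ S ∈ {S | S ∈ T ∧ affineSpan ℝ S ≠ ⊤}, S := by
        rintro x ⟨S, hS, hx⟩
        by_cases h : affineSpan ℝ S = ⊤
        · exact Or.inl (Set.mem_biUnion ((hF S).2 ⟨hS, h⟩) hx)
        · exact Or.inr (Set.mem_biUnion
            (show S ∈ {S | S ∈ T ∧ affineSpan ℝ S ≠ ⊤} from ⟨hS, h⟩) hx)
      refine (measure_mono hsub).trans ((measure_union_le _ _).trans ?_)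
      rw [(measure_biUnion_null_iff ((T.finite_toSet.subset fun S hS => hS.1).countable)).2
        fun S hS => volume_eq_zero_of_affineSpan_ne_top hS.2, add_zero]
    · exact Set.iUnion₂_subset fun S hS => Set.subset_sUnion_of_mem ((hF S).1 hS).1
  · intro S hS S' hS' hne
    obtain ⟨he, he'⟩ := h3 S ((hF S).1 hS).1 S' ((hF S').1 hS').1
    by_cases h : S ∩ S' = S
    · exact he'.volume_eq_zero (h.trans_ne hne)
    · exact he.volume_eq_zero h
  · intro S hS
    exact (h1 S ((hF S).1 hS).1).isLatticePolytope.isCompact.measurableSet.nullMeasurableSet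

theorem eq_of_subset_of_volume_eq {d : ℕ} {P S : Set (Fin d → ℝ)} (hP : IsCompact P)
    (hconv : Convex ℝ P) (hdim : affineSpan ℝ P = ⊤) (hS : IsCompact S) (hSP : S ⊆ P)
    (hvol : volume P = volume S) : P = S := by
  refine Set.Subset.antisymm ?_ hSP
  have hint : interior P ⊆ S := by
    rw [← Set.sdiff_eq_empty]
    refine (isOpen_interior.sdiff hS.isClosed).eq_empty_of_measure_zero (μ := volume)
      (measure_mono_null (Set.sdiff_subset_sdiff_left interior_subset) ?_)
    rw [measure_sdiff hSP hS.measurableSet.nullMeasurableSet hS.measure_lt_top.ne, hvol, tsub_self]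
  calc P = closure (interior P) := by
        rw [hconv.closure_interior_eq_closure_of_nonempty_interior
          (hconv.interior_nonempty_iff_affineSpan_eq_top.2 hdim), hP.isClosed.closure_eq]
    _ ⊆ S := closure_minimal hint hS.isClosed

/-- A full-dimensional lattice simplex with vertices in a polytope that does not span the lattice
has normalized volume at least `2`. -/
theorem IsLatticeSimplexOrEmpty.exists_hasDeltaPoly {d : ℕ} {P S : Set (Fin d → ℝ)}
    (hS : IsLatticeSimplexOrEmpty S) (htop : affineSpan ℝ S = ⊤) (hSP : S ⊆ P)
    (hspan : ¬ SpansLattice P) :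
    ∃ (q : Polynomial ℤ) (n : ℕ), HasDeltaPoly S q ∧ q.eval 1 = n ∧ 2 ≤ n ∧
      (n : ℝ) = (d.factorial : ℝ) * volume.real S := by
  obtain ⟨v, hv, hl, rfl⟩ := hS.exists_vertices htop
  obtain ⟨q, hq, hq1⟩ := exists_hasDeltaPoly_simplex hv hl
  refine ⟨q, _, hq, hq1, ?_, ?_⟩
  · have hpos : (simplexLambda v).ncard ≠ 0 :=
      Set.ncard_ne_zero_of_mem (zero_mem_simplexLambda v) (simplexLambda_finite hv)
    have hne : (simplexLambda v).ncard ≠ 1 := fun h =>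
      hspan (spansLattice_of_simplexLambda_ncard_eq_one hv hl
        (fun i => hSP (subset_convexHull ℝ _ ⟨i, rfl⟩)) h)
    omega
  · have := hq.eval_one_eq_volume (convex_convexHull ℝ _)
      ((Set.finite_range v).isCompact_convexHull ℝ)
    rw [← this, hq1]
    simp

theorem IsLatticeTriangulation.two_simplices {d : ℕ} {T : Finset (Set (Fin d → ℝ))}
    {P : Set (Fin d → ℝ)} (hT : IsLatticeTriangulation T P)
    (hP : IsLatticePolytope P) (hdim : affineSpan ℝ P = ⊤) (hns : ¬ IsSimplex P)
    (hvol : ∃ p : Polynomial ℤ, HasDeltaPoly P p ∧ p.eval 1 = 4)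
    (hspan : ¬ SpansLattice P) :
    ({S : Set (Fin d → ℝ) | S ∈ T ∧ affineSpan ℝ S = ⊤}).ncard = 2 ∧
      (∀ S ∈ T, affineSpan ℝ S = ⊤ →
        ∃ q : Polynomial ℤ, HasDeltaPoly S q ∧ q.eval 1 = 2) := by
  classical
  set F := T.filter fun S => affineSpan ℝ S = ⊤ with hFdef
  have hF : ∀ S, S ∈ F ↔ S ∈ T ∧ affineSpan ℝ S = ⊤ := fun S => by simp [hFdef]
  have hsub : ∀ S ∈ F, S ⊆ P := fun S hS => by
    rw [← hT.2.2.2]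
    exact Set.subset_sUnion_of_mem ((hF S).1 hS).1
  have hsimp : ∀ S ∈ F, IsLatticeSimplexOrEmpty S := fun S hS => hT.1 S ((hF S).1 hS).1
  have hex : ∀ S ∈ F, ∃ (q : Polynomial ℤ) (n : ℕ), HasDeltaPoly S q ∧ q.eval 1 = n ∧ 2 ≤ n ∧
      (n : ℝ) = (d.factorial : ℝ) * volume.real S := fun S hS =>
    (hsimp S hS).exists_hasDeltaPoly ((hF S).1 hS).2 (hsub S hS) hspan
  choose! q n hq hqn hn2 hnvol using hex
  obtain ⟨p, hp, hp4⟩ := hvol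
  have hsumvol := hT.volume_eq_sum F hF
  have hsum : ∑ S ∈ F, n S = 4 := by
    have h4 := hp.eval_one_eq_volume hP.convex hP.isCompact
    rw [hp4, measureReal_def, hsumvol, ENNReal.toReal_sum fun S hS =>
      (hsimp S hS).isLatticePolytope.isCompact.measure_lt_top.ne, Finset.mul_sum] at h4
    have h5 : ∑ S ∈ F, (n S : ℝ) = 4 := by
      rw [Finset.sum_congr rfl hnvol]
      exact_mod_cast h4.symm
    exact_mod_cast h5
  have hle : F.card * 2 ≤ 4 := by
    rw [← hsum, ← smul_eq_mul]
    exact Finset.card_nsmul_le_sum F n 2 hn2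
  have hne0 : F.card ≠ 0 := fun h => by
    rw [Finset.card_eq_zero.1 h] at hsum
    simp at hsum
  have hne1 : F.card ≠ 1 := fun h => by
    obtain ⟨S, hS⟩ := Finset.card_eq_one.1 h
    have hSF : S ∈ F := by simp [hS]
    rw [hS, Finset.sum_singleton] at hsumvol
    have hPS := eq_of_subset_of_volume_eq hP.isCompact hP.convex hdim
      (hsimp S hSF).isLatticePolytope.isCompact (hsub S hSF) hsumvol
    obtain ⟨v, hv, -, hSv⟩ := (hsimp S hSF).exists_vertices ((hF S).1 hSF).2
    exact hns ⟨d, v, hv, hPS.trans hSv⟩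
  have hcard : F.card = 2 := by omega
  refine ⟨?_, fun S hS htop => ⟨q S, hq S ((hF S).2 ⟨hS, htop⟩), ?_⟩⟩
  · rw [← hcard, ← Set.ncard_coe_finset]
    congr 1
    ext S
    exact (hF S).symm
  · obtain ⟨A, B, hAB, hFAB⟩ := Finset.card_eq_two.1 hcard
    have hSF := (hF S).2 ⟨hS, htop⟩
    have hA := hn2 A (by simp [hFAB])
    have hB := hn2 B (by simp [hFAB])
    rw [hFAB, Finset.sum_pair hAB] at hsum
    rw [hqn S hSF]
    rw [hFAB, Finset.mem_insert, Finset.mem_singleton] at hSF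
    rcases hSF with rfl | rfl <;> norm_cast <;> omega

end

/-- a non-simplex lattice polytope of normalized volume 4 whose lattice
points do not span `ℤ^{d+1}` contains no unimodular `d`-simplex (indeed any lattice
polytope containing a unimodular `d`-simplex spans), and every lattice triangulation of
it has exactly two `d`-dimensional simplices, each of normalized volume 2. -/
theorem volume_four_nonspanning_triangulations {d : ℕ} (P : Set (Fin d → ℝ))
    (hP : IsLatticePolytope P) (hdim : affineSpan ℝ P = ⊤) (hns : ¬ IsSimplex P)
    (hvol : ∃ p : Polynomial ℤ, HasDeltaPoly P p ∧ p.eval 1 = 4)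
    (hspan : ¬ SpansLattice P) :
    (¬ ∃ v : Fin (d + 1) → Fin d → ℝ, AffineIndependent ℝ v ∧
      (∀ i, v i ∈ latticePts d ∧ v i ∈ P) ∧
      (∃ q : Polynomial ℤ, HasDeltaPoly (convexHull ℝ (Set.range v)) q ∧ q.eval 1 = 1)) ∧
    (∀ Q : Set (Fin d → ℝ), IsLatticePolytope Q →
      (∃ v : Fin (d + 1) → Fin d → ℝ, AffineIndependent ℝ v ∧
        (∀ i, v i ∈ latticePts d ∧ v i ∈ Q) ∧
        (∃ q : Polynomial ℤ, HasDeltaPoly (convexHull ℝ (Set.range v)) q ∧ q.eval 1 = 1)) →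
      SpansLattice Q) ∧
    (∀ T : Finset (Set (Fin d → ℝ)), IsLatticeTriangulation T P →
      ({S : Set (Fin d → ℝ) | S ∈ T ∧ affineSpan ℝ S = ⊤}).ncard = 2 ∧
      (∀ S ∈ T, affineSpan ℝ S = ⊤ →
        ∃ q : Polynomial ℤ, HasDeltaPoly S q ∧ q.eval 1 = 2)) := by
  exact ⟨fun h => hspan (spansLattice_of_unimodular h),
    fun _ _ h => spansLattice_of_unimodular h,
    fun _ hT => hT.two_simplices hP hdim hns hvol hspan⟩
end
end
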